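/- There exists an absolute constant ε₀ > 0 such that for every ε > 0 there exist δ > 0 and N with: for every n ≥ N, every orgraph Γ on n vertices with at most δ·C(n,4) induced C⃗4's and whose underlying graph has edge density at least 2/3 − ε₀ satisfies: the number of edges of FDF(Γ) is at least (4/9 − ε)·C(n,3). -/

import Mathlib

open Finset

/-- `E` is an orgraph relation: no loops and no pair of opposite edges. -/
def IsOrgraph {V : Type*} (E : V → V → Prop) : Prop :=
  (∀ v, ¬ E v v) ∧ ∀ v w, E v w → ¬ E w v

/-- `E` contains an induced (oriented) 4-cycle: four distinct vertices whose
induced sub-orgraph has edge set exactly the oriented cycle. -/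
def HasInducedC4 {V : Type*} (E : V → V → Prop) : Prop :=
  ∃ v₁ v₂ v₃ v₄ : V,
    v₁ ≠ v₂ ∧ v₁ ≠ v₃ ∧ v₁ ≠ v₄ ∧ v₂ ≠ v₃ ∧ v₂ ≠ v₄ ∧ v₃ ≠ v₄ ∧
    E v₁ v₂ ∧ E v₂ v₃ ∧ E v₃ v₄ ∧ E v₄ v₁ ∧
    ¬ E v₂ v₁ ∧ ¬ E v₃ v₂ ∧ ¬ E v₄ v₃ ∧ ¬ E v₁ v₄ ∧
    ¬ E v₁ v₃ ∧ ¬ E v₃ v₁ ∧ ¬ E v₂ v₄ ∧ ¬ E v₄ v₂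

/-- The triple `{u,v,w}` spans an edge of `FDF(Γ)`: within the triple, some
vertex has out-degree 2, or some vertex has in-degree 0 and out-degree 0. -/
def FDFedge {V : Type*} (E : V → V → Prop) (u v w : V) : Prop :=
  (E u v ∧ E u w) ∨ (E v u ∧ E v w) ∨ (E w u ∧ E w v) ∨
  (¬ E u v ∧ ¬ E v u ∧ ¬ E u w ∧ ¬ E w u) ∨
  (¬ E v u ∧ ¬ E u v ∧ ¬ E v w ∧ ¬ E w v) ∨
  (¬ E w u ∧ ¬ E u w ∧ ¬ E w v ∧ ¬ E v w)

-- The number of edges of the 3-graph `FDF(Γ)`. 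
open Classical in
noncomputable def fdfCount (V : Type*) [Fintype V] (E : V → V → Prop) : ℕ :=
  ((Finset.univ.powersetCard 3).filter (fun s : Finset V =>
    ∃ u v w : V, u ≠ v ∧ u ≠ w ∧ v ≠ w ∧ s = {u, v, w} ∧ FDFedge E u v w)).card

-- The number of edges of the undirected graph underlying the orgraph `E`. 
open Classical in
noncomputable def underlyingEdgeCount (V : Type*) [Fintype V] (E : V → V → Prop) : ℕ :=
  ((Finset.univ.powersetCard 2).filter (fun s : Finset V =>
    ∃ u v : V, u ≠ v ∧ s = {u, v} ∧ (E u v ∨ E v u))).card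

-- The number of 4-sets of vertices spanning an induced C⃗₄ in the orgraph E. 
open Classical in
noncomputable def c4Count (V : Type*) [Fintype V] (E : V → V → Prop) : ℕ :=
  ((Finset.univ.powersetCard 4).filter (fun s : Finset V =>
    ∃ v₁ v₂ v₃ v₄ : V,
      v₁ ≠ v₂ ∧ v₁ ≠ v₃ ∧ v₁ ≠ v₄ ∧ v₂ ≠ v₃ ∧ v₂ ≠ v₄ ∧ v₃ ≠ v₄ ∧
      s = {v₁, v₂, v₃, v₄} ∧
      E v₁ v₂ ∧ E v₂ v₃ ∧ E v₃ v₄ ∧ E v₄ v₁ ∧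
      ¬ E v₂ v₁ ∧ ¬ E v₃ v₂ ∧ ¬ E v₄ v₃ ∧ ¬ E v₁ v₄ ∧
      ¬ E v₁ v₃ ∧ ¬ E v₃ v₁ ∧ ¬ E v₂ v₄ ∧ ¬ E v₄ v₂)).card


namespace FDFlb
open Finset

variable {V : Type} [Fintype V]

/-- weighted sum -/
noncomputable def av (w : V → ℝ) (f : V → ℝ) : ℝ := ∑ v, w v * f v

theorem av_add (w f g : V → ℝ) : av w (fun v => f v + g v) = av w f + av w g := by
  simp [av, mul_add, Finset.sum_add_distrib]

theorem av_sub (w f g : V → ℝ) : av w (fun v => f v - g v) = av w f - av w g := by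
  simp [av, mul_sub, Finset.sum_sub_distrib]

theorem av_neg (w f : V → ℝ) : av w (fun v => - f v) = - av w f := by
  simp [av]

theorem av_mul (w f : V → ℝ) (c : ℝ) : av w (fun v => c * f v) = c * av w f := by
  simp only [av, Finset.mul_sum]; exact Finset.sum_congr rfl fun _ _ => by ring

theorem av_mul_right (w f : V → ℝ) (c : ℝ) : av w (fun v => f v * c) = av w f * c := by
  simp only [av, Finset.sum_mul]; exact Finset.sum_congr rfl fun _ _ => by ring

theorem av_div (w f : V → ℝ) (c : ℝ) : av w (fun v => f v / c) = av w f / c := by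
  simp only [av, Finset.sum_div]; exact Finset.sum_congr rfl fun _ _ => by ring

theorem av_const (w : V → ℝ) (c : ℝ) : av w (fun _ => c) = c * av w (fun _ => 1) := by
  simp only [av, Finset.mul_sum]; exact Finset.sum_congr rfl fun _ _ => by ring

theorem av_comm {w w' : V → ℝ} (f : V → V → ℝ) :
    av w (fun u => av w' (fun v => f u v)) = av w' (fun v => av w (fun u => f u v)) := by
  simp only [av, Finset.mul_sum]
  rw [Finset.sum_comm]
  exact Finset.sum_congr rfl fun _ _ => Finset.sum_congr rfl fun _ _ => by ring

theorem av_mono' {w : V → ℝ} (hw : ∀ v, 0 ≤ w v) {f g : V → ℝ}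
    (h : ∀ v, w v ≠ 0 → f v ≤ g v) : av w f ≤ av w g := by
  refine Finset.sum_le_sum fun v _ => ?_
  by_cases hv : w v = 0
  · simp [hv]
  · exact mul_le_mul_of_nonneg_left (h v hv) (hw v)

theorem av_mono {w : V → ℝ} (hw : ∀ v, 0 ≤ w v) {f g : V → ℝ}
    (h : ∀ v, f v ≤ g v) : av w f ≤ av w g := av_mono' hw fun v _ => h v

theorem av_nonneg {w : V → ℝ} (hw : ∀ v, 0 ≤ w v) {f : V → ℝ}
    (h : ∀ v, 0 ≤ f v) : 0 ≤ av w f :=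
  Finset.sum_nonneg fun v _ => mul_nonneg (hw v) (h v)

theorem av_mono_w {w w' : V → ℝ} {f : V → ℝ} (h : ∀ v, w v ≤ w' v)
    (hf : ∀ v, 0 ≤ f v) : av w f ≤ av w' f :=
  Finset.sum_le_sum fun v _ => mul_le_mul_of_nonneg_right (h v) (hf v)

theorem av_congr' {w : V → ℝ} {f g : V → ℝ}
    (h : ∀ v, w v ≠ 0 → f v = g v) : av w f = av w g := by
  refine Finset.sum_congr rfl fun v _ => ?_
  by_cases hv : w v = 0
  · simp [hv]
  · rw [h v hv]

theorem av_congr {w : V → ℝ} {f g : V → ℝ}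
    (h : ∀ v, f v = g v) : av w f = av w g := av_congr' fun v _ => h v

theorem exists_of_av_pos {w : V → ℝ} {f : V → ℝ} (h : 0 < av w f) : ∃ v, w v ≠ 0 ∧ f v ≠ 0 := by
  by_contra hc
  push Not at hc
  have : av w f = 0 := by
    refine Finset.sum_eq_zero fun v _ => ?_
    by_cases hv : w v = 0
    · simp [hv]
    · simp [hc v hv]
  linarith

/-- Markov -/
theorem av_markov {w : V → ℝ} (hw : ∀ v, 0 ≤ w v) {f : V → ℝ} (hf : ∀ v, 0 ≤ f v) {t : ℝ}
    (ht : 0 < t) : av w (fun v => if t < f v then 1 else 0) ≤ av w f / t := by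
  rw [← av_div]
  refine av_mono hw fun v => ?_
  split_ifs with h
  · rw [le_div_iff₀ ht]; linarith
  · exact div_nonneg (hf v) ht.le

theorem av_sq {w : V → ℝ} (hw : ∀ v, 0 ≤ w v) (h1 : av w (fun _ => 1) = 1) (f : V → ℝ) (c : ℝ) :
    av w (fun v => (f v - c) ^ 2) = av w (fun v => (f v) ^ 2) - 2 * c * av w f + c ^ 2 := by
  have : ∀ v, (f v - c) ^ 2 = (f v) ^ 2 - 2 * c * f v + c ^ 2 := fun v => by ring
  simp only [this, av_add, av_sub, av_mul]
  rw [av_const w (c ^ 2), h1]; ring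

theorem av_cs {w : V → ℝ} (hw : ∀ v, 0 ≤ w v) (h1 : av w (fun _ => 1) = 1) (f : V → ℝ) :
    (av w f) ^ 2 ≤ av w (fun v => (f v) ^ 2) := by
  have h := av_sq hw h1 f (av w f)
  have : 0 ≤ av w (fun v => (f v - av w f) ^ 2) := av_nonneg hw fun v => sq_nonneg _
  nlinarith

/-- zero-one matrices of orgraphs -/
structure OG (e : V → V → ℝ) : Prop where
  zo : ∀ u v, e u v = 0 ∨ e u v = 1
  asym : ∀ u v, e u v = 0 ∨ e v u = 0

/-- adjacency -/
def ad (e : V → V → ℝ) (u v : V) : ℝ := e u v + e v u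
/-- non-adjacency -/
def nb (e : V → V → ℝ) (u v : V) : ℝ := 1 - e u v - e v u

section
variable {e : V → V → ℝ}

theorem OG.cases (h : OG e) (u v : V) : (e u v = 0 ∧ e v u = 0) ∨ (e u v = 1 ∧ e v u = 0) ∨
    (e u v = 0 ∧ e v u = 1) := by
  rcases h.zo u v with h1 | h1 <;> rcases h.zo v u with h2 | h2 <;>
    rcases h.asym u v with h3 | h3 <;> simp_all

theorem OG.e0 (h : OG e) (u v : V) : 0 ≤ e u v := by rcases h.zo u v with h | h <;> simp [h]
theorem OG.e1 (h : OG e) (u v : V) : e u v ≤ 1 := by rcases h.zo u v with h | h <;> simp [h]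
theorem OG.nb01 (h : OG e) (u v : V) : nb e u v = 0 ∨ nb e u v = 1 := by
  rcases h.cases u v with ⟨h1, h2⟩ | ⟨h1, h2⟩ | ⟨h1, h2⟩ <;> simp [nb, h1, h2]
theorem OG.nb0 (h : OG e) (u v : V) : 0 ≤ nb e u v := by rcases h.nb01 u v with h | h <;> simp [h]
theorem OG.nb1 (h : OG e) (u v : V) : nb e u v ≤ 1 := by rcases h.nb01 u v with h | h <;> simp [h]
theorem nb_eq (e : V → V → ℝ) (u v : V) : nb e u v = 1 - ad e u v := by simp [nb, ad]; ring
theorem ad_eq (e : V → V → ℝ) (u v : V) : ad e u v = 1 - nb e u v := by simp [nb, ad]; ring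
theorem OG.ad01 (h : OG e) (u v : V) : ad e u v = 0 ∨ ad e u v = 1 := by
  rcases h.nb01 u v with h | h <;> simp [ad_eq, h]
theorem OG.ad0 (h : OG e) (u v : V) : 0 ≤ ad e u v := by rcases h.ad01 u v with h | h <;> simp [h]
theorem OG.ad1 (h : OG e) (u v : V) : ad e u v ≤ 1 := by rcases h.ad01 u v with h | h <;> simp [h]
theorem nb_symm (e : V → V → ℝ) (u v : V) : nb e u v = nb e v u := by simp [nb]; ring
theorem ad_symm (e : V → V → ℝ) (u v : V) : ad e u v = ad e v u := by simp [ad]; ring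

/-- indicator of an induced oriented 4-cycle -/
def c4k (e : V → V → ℝ) (a b c d : V) : ℝ :=
  e a b * e b c * e c d * e d a * nb e a c * nb e b d

theorem OG.c4k0 (h : OG e) (a b c d : V) : 0 ≤ c4k e a b c d := by
  unfold c4k
  have := h.e0; have := h.nb0
  positivity [h.e0 a b, h.e0 b c, h.e0 c d, h.e0 d a, h.nb0 a c, h.nb0 b d]

/-- cycles through a vertex -/
noncomputable def HH (e : V → V → ℝ) (b c : V → ℝ) (y : V) : ℝ :=
  av c fun z => av b fun y2 => av c fun z2 => c4k e y z y2 z2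

theorem OG.HH0 (h : OG e) {b c : V → ℝ} (hb : ∀ v, 0 ≤ b v) (hc : ∀ v, 0 ≤ c v) (y : V) :
    0 ≤ HH e b c y :=
  av_nonneg hc fun _ => av_nonneg hb fun _ => av_nonneg hc fun _ => h.c4k0 _ _ _ _

end
end FDFlb


namespace FDFlb
open Finset
variable {V : Type} [Fintype V] {e : V → V → ℝ}

theorem dich_half (h : OG e) {b c : V → ℝ} (hb : ∀ v, 0 ≤ b v) (hc : ∀ v, 0 ≤ c v) {θ : ℝ}
    (hθ : 0 < θ)
    (hne : ∃ y, b y ≠ 0)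
    (hnb : ∀ y, b y ≠ 0 → av c (fun z => nb e y z) ≤ θ)
    (had : ∀ y, b y ≠ 0 → av b (fun z => ad e y z) ≤ θ)
    (hH : ∀ y, b y ≠ 0 → HH e b c y ≤ θ ^ 3)
    (hcc : av c (fun z => av c fun z' => ad e z z') ≤ θ ^ 2) :
    ∃ y1, b y1 ≠ 0 ∧ ∀ f : V → ℝ, (∀ v, 0 ≤ f v) → (∀ v, f v ≤ 1) →
      av b (fun y => f y * av c fun z => e y1 z * (1 - e y z)) ≤
        3 * θ * av b f + 2 * θ * av c (fun z => e y1 z) := by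
  classical
  obtain ⟨y1, hy1, hmin⟩ := Finset.exists_min_image (Finset.univ.filter fun y => b y ≠ 0)
    (fun y => av c fun z => e y z) (by obtain ⟨y, hy⟩ := hne; exact ⟨y, by simpa using hy⟩)
  have hy1 : b y1 ≠ 0 := by simpa using hy1
  have hmin : ∀ y, b y ≠ 0 → av c (fun z => e y1 z) ≤ av c (fun z => e y z) :=
    fun y hy => hmin y (by simpa using hy)
  refine ⟨y1, hy1, fun f hf0 hf1 => ?_⟩
  set mZ := av c (fun z => e y1 z) with hmZ
  have hmZ0 : 0 ≤ mZ := av_nonneg hc fun z => h.e0 _ _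
  set H2 : V → ℝ := fun y => av c fun z => av c fun z2 => c4k e y1 z y z2 with hH2
  have hH20 : ∀ y, 0 ≤ H2 y := fun y => av_nonneg hc fun _ => av_nonneg hc fun _ => h.c4k0 _ _ _ _
  have hH2s : av b H2 ≤ θ ^ 3 := by
    have := hH y1 hy1
    unfold HH at this
    rw [av_comm] at this
    exact this
  have key : ∀ y, b y ≠ 0 → (f y * av c fun z => e y1 z * (1 - e y z)) ≤
      3 * θ * f y + mZ * (ad e y1 y + H2 y / (3 * θ ^ 2)) := by
    intro y hy
    set E := av c fun z => e y1 z * (1 - e y z) with hE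
    have hEZ : E ≤ mZ := av_mono hc fun z => by nlinarith [h.e0 y1 z, h.e0 y z]
    have hE0 : 0 ≤ E := av_nonneg hc fun z => mul_nonneg (h.e0 _ _) (by linarith [h.e1 y z])
    by_cases h3 : E ≤ 3 * θ
    · have h1 : 0 ≤ mZ * (ad e y1 y + H2 y / (3 * θ ^ 2)) :=
        mul_nonneg hmZ0 (add_nonneg (h.ad0 _ _) (div_nonneg (hH20 y) (by positivity)))
      nlinarith [hf0 y]
    push Not at h3
    have hone : 1 ≤ ad e y1 y + H2 y / (3 * θ ^ 2) := by
      rcases h.ad01 y1 y with ha | ha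
      swap
      · rw [ha]; have := div_nonneg (hH20 y) (by positivity : 0 ≤ 3 * θ ^ 2); linarith
      rw [ha, zero_add, le_div_iff₀ (by positivity), one_mul]
      have hnb1 : nb e y1 y = 1 := by rw [nb_eq, ha]; ring
      set Q := av c fun z => e y z * (1 - e y1 z) with hQ
      have hQE : E ≤ Q := by
        have : Q - E = av c (fun z => e y z) - mZ := by
          rw [hQ, hE, hmZ, ← av_sub, ← av_sub]
          exact av_congr fun z => by ring
        linarith [hmin y hy]
      set E' := av c fun z => e y1 z * e z y with hE'
      set Q' := av c fun z => e y z * e z y1 with hQ'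
      have h1 : E - θ ≤ E' := by
        have : E ≤ E' + av c (fun z => nb e y z) := by
          rw [hE, hE', ← av_add]
          refine av_mono hc fun z => ?_
          unfold nb
          nlinarith [h.e0 y1 z, h.e1 y1 z, h.nb0 y z, show nb e y z = 1 - e y z - e z y from rfl]
        linarith [hnb y hy]
      have h2 : Q - θ ≤ Q' := by
        have : Q ≤ Q' + av c (fun z => nb e y1 z) := by
          rw [hQ, hQ', ← av_add]
          refine av_mono hc fun z => ?_
          unfold nb
          nlinarith [h.e0 y z, h.e1 y z, h.nb0 y1 z, show nb e y1 z = 1 - e y1 z - e z y1 from rfl]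
        linarith [hnb y1 hy1]
      have h4 : E' * Q' ≤ H2 y + av c (fun z => av c fun z' => ad e z z') := by
        rw [hE', hQ', hH2]
        simp only
        rw [← av_add, ← av_mul_right]
        refine av_mono hc fun z => ?_
        rw [← av_add, ← av_mul]
        refine av_mono hc fun z' => ?_
        unfold c4k
        rw [hnb1]
        rcases h.ad01 z z' with hz | hz
        · rw [nb_eq, hz]; ring_nf; exact le_refl _
        · rw [nb_eq, hz]
          have a1 : e y1 z * e z y ≤ 1 := mul_le_one₀ (h.e1 _ _) (h.e0 _ _) (h.e1 _ _)
          have a2 : e y z' * e z' y1 ≤ 1 := mul_le_one₀ (h.e1 _ _) (h.e0 _ _) (h.e1 _ _)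
          have a3 : 0 ≤ e y z' * e z' y1 := mul_nonneg (h.e0 _ _) (h.e0 _ _)
          have := mul_le_one₀ a1 a3 a2
          simpa using this
      have h5 : (2 * θ) * (2 * θ) ≤ E' * Q' :=
        mul_le_mul (by linarith) (by linarith) (by linarith) (by linarith)
      nlinarith
    have : f y * E ≤ mZ * 1 := by nlinarith [hf0 y, hf1 y]
    nlinarith [mul_le_mul_of_nonneg_left hone hmZ0, hf0 y, mul_nonneg hθ.le (hf0 y)]
  have := av_mono' hb key
  rw [av_add, av_mul, av_mul, av_add, av_div] at this
  have h6 : av b H2 / (3 * θ ^ 2) ≤ θ := by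
    rw [div_le_iff₀ (by positivity)]
    nlinarith [pow_pos hθ 3]
  have h7 := had y1 hy1
  have : mZ * (av b (ad e y1) + av b H2 / (3 * θ ^ 2)) ≤ mZ * (2 * θ) :=
    mul_le_mul_of_nonneg_left (by
      have : av b (ad e y1) = av b (fun z => ad e y1 z) := rfl
      linarith) hmZ0
  have h8 : av b (fun v => f v) = av b f := rfl
  linarith

theorem dich_good (h : OG e) {b0 c0 : V → ℝ} (hb : ∀ v, 0 ≤ b0 v) (hc : ∀ v, 0 ≤ c0 v) {θ L M : ℝ}
    (hθ : 0 < θ)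
    (hbb : av b0 (fun y => av b0 fun y' => ad e y y') ≤ θ ^ 2 / 8)
    (hbc : av b0 (fun y => av c0 fun z => nb e y z) ≤ θ ^ 2 / 8)
    (hH : av b0 (HH e b0 c0) ≤ θ ^ 4)
    (hM : M ≤ av b0 (fun _ => 1))
    (h2 : av b0 (fun y => if av c0 (fun z => e y z) < L then 1 else 0) < M - 20 * θ) :
    ∃ b : V → ℝ, (∀ v, 0 ≤ b v) ∧ (∀ v, b v ≤ b0 v) ∧ (∃ y, b y ≠ 0) ∧
      (∀ y, b y ≠ 0 → L ≤ av c0 (fun z => e y z)) ∧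
      (∀ y, b y ≠ 0 → av c0 (fun z => nb e y z) ≤ θ) ∧
      (∀ y, b y ≠ 0 → av b0 (fun z => ad e y z) ≤ θ) ∧
      (∀ y, b y ≠ 0 → HH e b0 c0 y ≤ θ ^ 3) ∧
      av b0 (fun _ => 1) - av b (fun _ => 1) ≤ M - 18 * θ := by
  classical
  set i1 : V → ℝ := fun y => if av c0 (fun z => e y z) < L then 1 else 0 with hi1
  set i2 : V → ℝ := fun y => if θ < av c0 (fun z => nb e y z) then 1 else 0 with hi2
  set i3 : V → ℝ := fun y => if θ < av b0 (fun z => ad e y z) then 1 else 0 with hi3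
  set i4 : V → ℝ := fun y => if θ ^ 3 < HH e b0 c0 y then 1 else 0 with hi4
  have m2 : av b0 i2 ≤ θ / 8 := by
    refine (av_markov hb (fun y => av_nonneg hc fun z => h.nb0 _ _) hθ).trans ?_
    rw [div_le_iff₀ hθ]; linarith
  have m3 : av b0 i3 ≤ θ / 8 := by
    refine (av_markov hb (fun y => av_nonneg hb fun z => h.ad0 _ _) hθ).trans ?_
    rw [div_le_iff₀ hθ]; linarith
  have m4 : av b0 i4 ≤ θ := by
    refine (av_markov hb (fun y => h.HH0 hb hc y) (by positivity)).trans ?_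
    rw [div_le_iff₀ (by positivity)]
    calc _ ≤ θ ^ 4 := hH
      _ = _ := by ring
  let P : V → Prop := fun y => av c0 (fun z => e y z) < L ∨ θ < av c0 (fun z => nb e y z) ∨
    θ < av b0 (fun z => ad e y z) ∨ θ ^ 3 < HH e b0 c0 y
  let b : V → ℝ := fun y => if P y then 0 else b0 y
  have hP : ∀ y, b y ≠ 0 → ¬ P y := fun y hy hp => hy (by simp [b, hp])
  have hmass : av b0 (fun _ => 1) - av b (fun _ => 1) ≤ M - 18 * θ := by
    have : av b0 (fun _ => 1) - av b (fun _ => 1) ≤ av b0 (fun y => i1 y + i2 y + i3 y + i4 y) := by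
      unfold av
      rw [← Finset.sum_sub_distrib]
      refine Finset.sum_le_sum fun y _ => ?_
      have k1 : 0 ≤ i1 y := by simp only [hi1]; split_ifs <;> norm_num
      have k2 : 0 ≤ i2 y := by simp only [hi2]; split_ifs <;> norm_num
      have k3 : 0 ≤ i3 y := by simp only [hi3]; split_ifs <;> norm_num
      have k4 : 0 ≤ i4 y := by simp only [hi4]; split_ifs <;> norm_num
      by_cases hp : P y
      · have : 1 ≤ i1 y + i2 y + i3 y + i4 y := by
          rcases hp with hp | hp | hp | hp
          · have : i1 y = 1 := by simp only [hi1, if_pos hp]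
            linarith
          · have : i2 y = 1 := by simp only [hi2, if_pos hp]
            linarith
          · have : i3 y = 1 := by simp only [hi3, if_pos hp]
            linarith
          · have : i4 y = 1 := by simp only [hi4, if_pos hp]
            linarith
        have hby : b y = 0 := by simp [b, hp]
        rw [hby]
        nlinarith [hb y]
      · have hby : b y = b0 y := by simp [b, hp]
        rw [hby]
        have := mul_nonneg (hb y) (by linarith : 0 ≤ i1 y + i2 y + i3 y + i4 y)
        linarith
    rw [av_add, av_add, av_add] at this
    have e1 : av b0 (fun y => i1 y) = av b0 i1 := rfl
    have e2 : av b0 (fun y => i2 y) = av b0 i2 := rfl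
    have e3 : av b0 (fun y => i3 y) = av b0 i3 := rfl
    have e4 : av b0 (fun y => i4 y) = av b0 i4 := rfl
    linarith
  refine ⟨b, fun v => ?_, fun v => ?_, ?_, fun y hy => ?_, fun y hy => ?_, fun y hy => ?_,
    fun y hy => ?_, hmass⟩
  · simp only [b]; split_ifs; exacts [le_refl _, hb v]
  · simp only [b]; split_ifs; exacts [hb v, le_refl _]
  · obtain ⟨y, hy, -⟩ := exists_of_av_pos (w := b) (f := fun _ => 1) (by linarith)
    exact ⟨y, hy⟩
  all_goals
    have := hP y hy
    simp only [P, not_or, not_lt] at this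
  exacts [this.1, this.2.1, this.2.2.1, this.2.2.2]

theorem HH_mono (h : OG e) {b c b0 c0 : V → ℝ} (hb : ∀ v, 0 ≤ b v) (hc : ∀ v, 0 ≤ c v)
    (hb0 : ∀ v, b v ≤ b0 v) (hc0 : ∀ v, c v ≤ c0 v) (y : V) : HH e b c y ≤ HH e b0 c0 y := by
  have hb' : ∀ v, 0 ≤ b0 v := fun v => (hb v).trans (hb0 v)
  have hc' : ∀ v, 0 ≤ c0 v := fun v => (hc v).trans (hc0 v)
  unfold HH
  refine (av_mono_w hc0 fun z => av_nonneg hb fun _ => av_nonneg hc fun _ => h.c4k0 _ _ _ _).trans ?_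
  refine av_mono hc' fun z => ?_
  refine (av_mono_w hb0 fun z => av_nonneg hc fun _ => h.c4k0 _ _ _ _).trans ?_
  refine av_mono hb' fun z => ?_
  exact av_mono_w hc0 fun z => h.c4k0 _ _ _ _

theorem av_drop {c c0 : V → ℝ} (hc0 : ∀ v, c v ≤ c0 v) {f : V → ℝ} (hf1 : ∀ v, f v ≤ 1) :
    av c0 f - av c f ≤ av c0 (fun _ => 1) - av c (fun _ => 1) := by
  unfold av
  rw [← Finset.sum_sub_distrib, ← Finset.sum_sub_distrib]
  exact Finset.sum_le_sum fun v _ => by nlinarith [hf1 v, hc0 v]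

theorem dich (h : OG e) {b0 c0 : V → ℝ} (hb : ∀ v, 0 ≤ b0 v) (hc : ∀ v, 0 ≤ c0 v) {θ L M : ℝ}
    (hθ : 0 < θ)
    (hbb : av b0 (fun y => av b0 fun y' => ad e y y') ≤ θ ^ 2 / 8)
    (hcc : av c0 (fun y => av c0 fun y' => ad e y y') ≤ θ ^ 2 / 8)
    (hbc : av b0 (fun y => av c0 fun z => nb e y z) ≤ θ ^ 2 / 8)
    (hH : av b0 (HH e b0 c0) ≤ θ ^ 4)
    (hH' : av c0 (HH e c0 b0) ≤ θ ^ 4)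
    (hM : M ≤ av b0 (fun _ => 1))
    (hL : L ≤ av c0 (fun _ => 1))
    (h1 : av c0 (fun z => if av b0 (fun y => e z y) < M then 1 else 0) < L - 20 * θ)
    (h2 : av b0 (fun y => if av c0 (fun z => e y z) < L then 1 else 0) < M - 20 * θ) : False := by
  have hcb : av c0 (fun y => av b0 fun z => nb e y z) ≤ θ ^ 2 / 8 := by
    rw [av_comm]
    simpa only [nb_symm e] using hbc
  obtain ⟨b, b_0, b_le, b_ne, b1, b2, b3, b4, b5⟩ := dich_good h hb hc hθ hbb hbc hH hM h2
  obtain ⟨c, c_0, c_le, c_ne, c1, c2, c3, c4, c5⟩ := dich_good h hc hb hθ hcc hcb hH' hL h1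
  have sub : ∀ {b c b0 c0 : V → ℝ}, (∀ v, 0 ≤ c v) → (∀ v, b v ≤ b0 v) → (∀ v, c v ≤ c0 v) →
      (∀ v, 0 ≤ b0 v) →
      av c0 (fun y => av b0 fun y' => ad e y y') ≤ θ ^ 2 / 8 →
      av c (fun y => av b fun y' => ad e y y') ≤ θ ^ 2 := by
    intro b c b0 c0 hc hb hc' hb' hh
    have : av c (fun y => av b fun y' => ad e y y') ≤ av c0 (fun y => av b0 fun y' => ad e y y') := by
      refine (av_mono hc fun y => av_mono_w hb fun z => h.ad0 _ _).trans ?_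
      exact av_mono_w hc' fun y => av_nonneg hb' fun z => h.ad0 _ _
    nlinarith [sq_nonneg θ]
  obtain ⟨y1, hy1, Hy⟩ := dich_half h b_0 c_0 hθ b_ne
    (fun y hy => (av_mono_w c_le fun z => h.nb0 _ _).trans (b2 y hy))
    (fun y hy => (av_mono_w b_le fun z => h.ad0 _ _).trans (b3 y hy))
    (fun y hy => (HH_mono h b_0 c_0 b_le c_le y).trans (b4 y hy))
    (sub c_0 c_le c_le hc hcc)
  obtain ⟨z1, hz1, Hz⟩ := dich_half h c_0 b_0 hθ c_ne
    (fun y hy => (av_mono_w b_le fun z => h.nb0 _ _).trans (c2 y hy))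
    (fun y hy => (av_mono_w c_le fun z => h.ad0 _ _).trans (c3 y hy))
    (fun y hy => (HH_mono h c_0 b_0 c_le b_le y).trans (c4 y hy))
    (sub b_0 b_le b_le hb hbb)
  have Hy := Hy (fun y => e z1 y) (fun v => h.e0 _ _) (fun v => h.e1 _ _)
  have Hz := Hz (fun y => e y1 y) (fun v => h.e0 _ _) (fun v => h.e1 _ _)
  set mY := av b (fun y => e z1 y) with hmY
  set mZ := av c (fun y => e y1 y) with hmZ
  have hY : 18 * θ ≤ mY := by
    have := av_drop b_le (f := fun y => e z1 y) (fun v => h.e1 _ _)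
    have := c1 z1 hz1
    linarith
  have hZ : 18 * θ ≤ mZ := by
    have := av_drop c_le (f := fun y => e y1 y) (fun v => h.e1 _ _)
    have := b1 y1 hy1
    linarith
  have hsum : mY * mZ ≤ av b (fun y => e z1 y * av c fun z => e y1 z * (1 - e y z)) +
      av c (fun y => e y1 y * av b fun z => e z1 z * (1 - e y z)) := by
    have e2 : av c (fun y => e y1 y * av b fun z => e z1 z * (1 - e y z)) =
        av b (fun y => e z1 y * av c fun z => e y1 z * (1 - e z y)) := by
      simp only [← av_mul]
      rw [av_comm]
      exact av_congr fun y => av_congr fun z => by ring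
    rw [e2, ← av_add, hmY, ← av_mul_right]
    refine av_mono b_0 fun y => ?_
    rw [← mul_add, ← av_add]
    refine mul_le_mul_of_nonneg_left ?_ (h.e0 _ _)
    refine av_mono c_0 fun z => ?_
    have := h.nb0 y z
    unfold nb at this
    nlinarith [h.e0 y1 z]
  nlinarith

end FDFlb


namespace FDFlb
open Finset

variable {V : Type} [Fintype V] {e : V → V → ℝ}

theorem nine {t τ g1 g2 g3 h1 h2 h3 : ℝ} (ht : 0 ≤ t) (hτ : 0 ≤ τ)
    (hg1 : 0 ≤ g1) (hg2 : 0 ≤ g2) (hg3 : 0 ≤ g3) (hh1 : 0 ≤ h1) (hh2 : 0 ≤ h2) (hh3 : 0 ≤ h3)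
    (d11 : t - τ ≤ g1 ∨ t - τ ≤ h1) (d12 : 2 * t - τ ≤ g1 ∨ t - τ ≤ h2)
    (d13 : 3 * t - τ ≤ g1 ∨ t - τ ≤ h3)
    (d21 : t - τ ≤ g2 ∨ 2 * t - τ ≤ h1) (d22 : 2 * t - τ ≤ g2 ∨ 2 * t - τ ≤ h2)
    (d23 : 3 * t - τ ≤ g2 ∨ 2 * t - τ ≤ h3)
    (d31 : t - τ ≤ g3 ∨ 3 * t - τ ≤ h1) (d32 : 2 * t - τ ≤ g3 ∨ 3 * t - τ ≤ h2)
    (d33 : 3 * t - τ ≤ g3 ∨ 3 * t - τ ≤ h3) :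
    19 * t - 18 * τ ≤ 5 * (g1 + h1) + 3 * (g2 + h2) + (g3 + h3) := by
  rcases d11 with d11 | d11 <;> rcases d12 with d12 | d12 <;> rcases d21 with d21 | d21 <;>
  rcases d22 with d22 | d22 <;> first | linarith | skip
  all_goals
    rcases d13 with d13 | d13 <;> rcases d31 with d31 | d31 <;> first | linarith | skip
  all_goals
    rcases d23 with d23 | d23 <;> rcases d32 with d32 | d32 <;> first | linarith | skip
  all_goals
    rcases d33 with d33 | d33 <;> linarith

theorem ptw {S i φ x : ℝ} (hS : 0 ≤ S) (hi : 0 ≤ i)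
    (hx : S - i - φ ≤ x) :
    S ^ 2 / 16 * (5 * (if φ < 1 * (S / 4) then 1 else 0) + 3 * (if φ < 2 * (S / 4) then 1 else 0)
      + (if φ < 3 * (S / 4) then 1 else 0)) - 2 * S * i ≤ x ^ 2 := by
  have key : ∀ a : ℝ, 0 ≤ a → a ≤ S → a - i ≤ x → a ^ 2 - 2 * S * i ≤ x ^ 2 := by
    intro a ha haS hax
    by_cases hia : i ≤ a
    · nlinarith [mul_nonneg hi (sub_nonneg.2 haS)]
    · push Not at hia
      nlinarith [mul_nonneg hi (sub_nonneg.2 haS), sq_nonneg x]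
  have hSi : 0 ≤ S * i := mul_nonneg hS hi
  by_cases h1 : φ < 1 * (S / 4)
  · rw [if_pos h1, if_pos (by linarith), if_pos (by linarith)]
    have := key (3 * S / 4) (by linarith) (by linarith) (by linarith)
    nlinarith
  · rw [if_neg h1]
    by_cases h2 : φ < 2 * (S / 4)
    · rw [if_pos h2, if_pos (by linarith)]
      have := key (2 * S / 4) (by linarith) (by linarith) (by linarith)
      nlinarith
    · rw [if_neg h2]
      by_cases h3 : φ < 3 * (S / 4)
      · rw [if_pos h3]
        have := key (1 * S / 4) (by linarith) (by linarith) (by linarith)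
        nlinarith
      · rw [if_neg h3]
        nlinarith [sq_nonneg x]

/-- class indicator -/
def ind (c : V → Fin 3) (k : Fin 3) (v : V) : ℝ := if c v = k then 1 else 0
/-- same class -/
def sm (c : V → Fin 3) (u v : V) : ℝ := if c u = c v then 1 else 0

/-- inner bad degree -/
noncomputable def ib (w : V → ℝ) (e : V → V → ℝ) (c : V → Fin 3) (v : V) : ℝ :=
  av w fun u => sm c v u * ad e v u
/-- outer bad degree -/
noncomputable def ob (w : V → ℝ) (e : V → V → ℝ) (c : V → Fin 3) (v : V) : ℝ :=
  av w fun u => (1 - sm c v u) * nb e v u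
/-- out-degree -/
noncomputable def dd (w : V → ℝ) (e : V → V → ℝ) (v : V) : ℝ := av w fun u => e v u
/-- non-degree -/
noncomputable def nn (w : V → ℝ) (e : V → V → ℝ) (v : V) : ℝ := av w fun u => nb e v u

/-- cherries density -/
noncomputable def KK (w : V → ℝ) (e : V → V → ℝ) : ℝ :=
  av w fun v => av w fun u => av w fun x => nb e v u * nb e v x * ad e u x
/-- the functional -/
noncomputable def PP (w : V → ℝ) (e : V → V → ℝ) : ℝ :=
  3 * av w (fun v => dd w e v ^ 2) + av w (fun v => nn w e v ^ 2) + 2 * KK w e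

theorem ind0 (c : V → Fin 3) (k : Fin 3) (v : V) : 0 ≤ ind c k v := by
  unfold ind; split_ifs <;> norm_num
theorem ind1 (c : V → Fin 3) (k : Fin 3) (v : V) : ind c k v ≤ 1 := by
  unfold ind; split_ifs <;> norm_num
theorem sm0 (c : V → Fin 3) (k v : V) : 0 ≤ sm c k v := by
  unfold sm; split_ifs <;> norm_num
theorem sm1 (c : V → Fin 3) (k v : V) : sm c k v ≤ 1 := by
  unfold sm; split_ifs <;> norm_num

theorem ib0 {w : V → ℝ} (hw : ∀ v, 0 ≤ w v) (h : OG e) (c : V → Fin 3) (v : V) : 0 ≤ ib w e c v :=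
  av_nonneg hw fun _ => mul_nonneg (sm0 _ _ _) (h.ad0 _ _)
theorem ob0 {w : V → ℝ} (hw : ∀ v, 0 ≤ w v) (h : OG e) (c : V → Fin 3) (v : V) : 0 ≤ ob w e c v :=
  av_nonneg hw fun u => mul_nonneg (by linarith [sm1 c v u]) (h.nb0 _ _)

theorem av_w_mul (w p f : V → ℝ) : av (fun v => w v * p v) f = av w fun v => p v * f v := by
  unfold av; exact Finset.sum_congr rfl fun _ _ => by ring

theorem core_nn (h : OG e) {w : V → ℝ} (hw : ∀ v, 0 ≤ w v) (c : V → Fin 3) {kB kC : Fin 3} (hBC : kB ≠ kC)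
    {S : ℝ} (hS : 0 < S)
    (hβ : av w (ib w e c) + av w (ob w e c) ≤ 3 / 2 * S ^ 3)
    (hSs : S ≤ 1 / 10 ^ 8)
    (hC4 : av w (HH e w w) ≤ (S / 1000) ^ 4)
    (haB : 1 / 3 ≤ av w (ind c kB)) (haC : 1 / 3 ≤ av w (ind c kC))
    {L M : ℝ} (hL : L ≤ 1 / 3) (hM : M ≤ 1 / 3) :
    M - S / 50 ≤ av (fun v => w v * ind c kB v)
        (fun y => if av (fun v => w v * ind c kC v) (fun z => e y z) < L then 1 else 0) ∨
    L - S / 50 ≤ av (fun v => w v * ind c kC v)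
        (fun y => if av (fun v => w v * ind c kB v) (fun z => e y z) < M then 1 else 0) := by
  by_contra hcon
  push Not at hcon
  obtain ⟨h2, h1⟩ := hcon
  have hwk : ∀ k v, 0 ≤ w v * ind c k v := fun k v => mul_nonneg (hw v) (ind0 _ _ _)
  have hwk1 : ∀ k v, w v * ind c k v ≤ w v := fun k v =>
    mul_le_of_le_one_right (hw v) (ind1 _ _ _)
  have hi0 : 0 ≤ av w (ib w e c) := av_nonneg hw (ib0 hw h c)
  have ho0 : 0 ≤ av w (ob w e c) := av_nonneg hw (ob0 hw h c)
  have hθ : (3:ℝ) / 2 * S ^ 3 ≤ (S / 1000) ^ 2 / 8 := by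
    have : S ^ 3 ≤ 1 / 10 ^ 8 * S ^ 2 := by nlinarith [sq_nonneg S]
    nlinarith [sq_nonneg S]
  have hbb : ∀ k, av (fun v => w v * ind c k v) (fun y => av (fun v => w v * ind c k v)
      fun y' => ad e y y') ≤ (S / 1000) ^ 2 / 8 := by
    intro k
    refine le_trans ?_ (show av w (ib w e c) ≤ _ by linarith)
    rw [av_w_mul]
    refine av_mono hw fun v => ?_
    rw [av_w_mul]
    unfold ib
    rw [← av_mul]
    refine av_mono hw fun u => ?_
    have := h.ad0 v u
    unfold ind sm
    split_ifs <;> simp_all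
  have hbc : av (fun v => w v * ind c kB v) (fun y => av (fun v => w v * ind c kC v)
      fun y' => nb e y y') ≤ (S / 1000) ^ 2 / 8 := by
    refine le_trans ?_ (show av w (ob w e c) ≤ _ by linarith)
    rw [av_w_mul]
    refine av_mono hw fun v => ?_
    rw [av_w_mul]
    unfold ob
    rw [← av_mul]
    refine av_mono hw fun u => ?_
    have := h.nb0 v u
    unfold ind sm
    split_ifs <;> simp_all
  have hHH : ∀ k l, av (fun v => w v * ind c k v) (HH e (fun v => w v * ind c k v) (fun v => w v * ind c l v))
      ≤ (S / 1000) ^ 4 := by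
    intro k l
    refine le_trans ?_ hC4
    refine (av_mono (hwk k) fun v => HH_mono h (hwk k) (hwk l) (hwk1 k) (hwk1 l) v).trans ?_
    exact av_mono_w (hwk1 k) (h.HH0 hw hw)
  refine dich h (hwk kB) (hwk kC) (θ := S / 1000) (L := L) (M := M) (by positivity) (hbb kB) (hbb kC) hbc
    (hHH kB kC) (hHH kC kB) ?_ ?_ ?_ ?_
  · rw [av_w_mul]; simp only [mul_one]; linarith
  · rw [av_w_mul]; simp only [mul_one]; linarith
  · linarith
  · linarith

theorem core_half (h : OG e) {w : V → ℝ} (hw : ∀ v, 0 ≤ w v)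
    (c : V → Fin 3) {kA kB kC : Fin 3}
    (hcov : ∀ k, k = kA ∨ k = kB ∨ k = kC) {S1 S m : ℝ} (hS1 : 0 ≤ S1)
    (hA : av w (ind c kA) = 1 / 3 - S) (hm : 1 / 3 - S + S1 ≤ m) (v : V) (hv : c v = kB) :
    S1 ^ 2 / 16 * (5 * (if av (fun v => w v * ind c kC v) (fun z => e v z) < 1 * (S1 / 4) then 1 else 0)
      + 3 * (if av (fun v => w v * ind c kC v) (fun z => e v z) < 2 * (S1 / 4) then 1 else 0)
      + (if av (fun v => w v * ind c kC v) (fun z => e v z) < 3 * (S1 / 4) then 1 else 0))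
      - 2 * S1 * ib w e c v ≤ (dd w e v - m) ^ 2 := by
  have hwk : ∀ k v, 0 ≤ w v * ind c k v := fun k v => mul_nonneg (hw v) (ind0 _ _ _)
  have key : dd w e v ≤ av w (ind c kA) + ib w e c v +
      av (fun v => w v * ind c kC v) (fun z => e v z) := by
    rw [av_w_mul]; unfold dd ib
    rw [← av_add, ← av_add]
    refine av_mono hw fun u => ?_
    have h0 := h.e0 v u
    have h1 := h.e1 v u
    have h2 := h.e0 u v
    rcases hcov (c u) with hu | hu | hu
    · have : 0 ≤ sm c v u * ad e v u := mul_nonneg (sm0 _ _ _) (h.ad0 _ _)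
      have h4 : 0 ≤ ind c kC u * e v u := mul_nonneg (ind0 _ _ _) h0
      have : ind c kA u = 1 := by simp [ind, hu]
      linarith
    · have h4 : 0 ≤ ind c kC u * e v u := mul_nonneg (ind0 _ _ _) h0
      have := ind0 c kA u
      have : sm c v u = 1 := by simp [sm, hv, hu]
      rw [this]; unfold ad; linarith
    · have : 0 ≤ sm c v u * ad e v u := mul_nonneg (sm0 _ _ _) (h.ad0 _ _)
      have := ind0 c kA u
      have h4 : ind c kC u = 1 := by simp [ind, hu]
      rw [h4]; linarith
  have := ptw (S := S1) (i := ib w e c v) (φ := av (fun v => w v * ind c kC v) (fun z => e v z))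
    (x := m - dd w e v) hS1 (ib0 hw h c v) (by linarith)
  calc _ ≤ _ := this
    _ = _ := by ring

set_option maxHeartbeats 2000000 in
theorem core (h : OG e) {w : V → ℝ} (hw : ∀ v, 0 ≤ w v)
    (c : V → Fin 3) {kA kB kC : Fin 3} (hBC : kB ≠ kC)
    (hcov : ∀ k, k = kA ∨ k = kB ∨ k = kC) {S m : ℝ} (hS : 0 < S)
    (hA : av w (ind c kA) = 1 / 3 - S)
    (hβ : av w (ib w e c) + av w (ob w e c) ≤ 3 / 2 * S ^ 3)
    (hSs : S ≤ 1 / 10 ^ 8)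
    (hC4 : av w (HH e w w) ≤ (S / 1000) ^ 4)
    (haB : 1 / 3 ≤ av w (ind c kB)) (haC : 1 / 3 ≤ av w (ind c kC))
    (hm : 1 / 3 - S ^ 2 - S ^ 3 ≤ m) (hVar : av w (fun v => (dd w e v - m) ^ 2) ≤ S ^ 3 / 4) : False := by
  have hwk : ∀ k v, 0 ≤ w v * ind c k v := fun k v => mul_nonneg (hw v) (ind0 _ _ _)
  have hi0 : 0 ≤ av w (ib w e c) := av_nonneg hw (ib0 hw h c)
  have ho0 : 0 ≤ av w (ob w e c) := av_nonneg hw (ob0 hw h c)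
  set S1 : ℝ := S - S ^ 2 - S ^ 3 with hS1
  have hS2 : S ^ 2 ≤ S / 10 ^ 8 := by nlinarith
  have hS3 : S ^ 3 ≤ S ^ 2 / 10 ^ 8 := by nlinarith [sq_nonneg S]
  have hS1l : 0.999 * S ≤ S1 := by rw [hS1]; nlinarith
  have hS1u : S1 ≤ S := by rw [hS1]; nlinarith [pow_pos hS 3]
  have hS10 : 0 ≤ S1 := by linarith
  have D := fun (L M : ℝ) (hL : L ≤ 1 / 3) (hM : M ≤ 1 / 3) =>
    core_nn h hw c hBC hS hβ hSs hC4 haB haC hL hM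
  have hs4 : S1 / 4 ≤ 1 / 9 := by nlinarith
  set b0 : V → ℝ := fun v => w v * ind c kB v with hb0
  set c0 : V → ℝ := fun v => w v * ind c kC v with hc0
  set g : ℝ → ℝ := fun L => av b0 (fun y => if av c0 (fun z => e y z) < L then 1 else 0) with hg
  set k : ℝ → ℝ := fun M => av c0 (fun y => if av b0 (fun z => e y z) < M then 1 else 0) with hk
  have hg0 : ∀ L, 0 ≤ g L := fun L => av_nonneg (hwk kB) fun v => by split_ifs <;> norm_num
  have hk0 : ∀ L, 0 ≤ k L := fun L => av_nonneg (hwk kC) fun v => by split_ifs <;> norm_num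
  have nine' := nine (t := S1 / 4) (τ := S / 50) (g1 := g (1 * (S1 / 4))) (g2 := g (2 * (S1 / 4)))
    (g3 := g (3 * (S1 / 4))) (h1 := k (1 * (S1 / 4))) (h2 := k (2 * (S1 / 4))) (h3 := k (3 * (S1 / 4)))
    (by linarith) (by linarith) (hg0 _) (hg0 _) (hg0 _) (hk0 _) (hk0 _) (hk0 _)
    (by have := D (1 * (S1 / 4)) (1 * (S1 / 4)) (by linarith) (by linarith); simpa using this)
    (by have := D (1 * (S1 / 4)) (2 * (S1 / 4)) (by linarith) (by linarith); simpa using this)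
    (by have := D (1 * (S1 / 4)) (3 * (S1 / 4)) (by linarith) (by linarith); simpa using this)
    (by have := D (2 * (S1 / 4)) (1 * (S1 / 4)) (by linarith) (by linarith); simpa using this)
    (by have := D (2 * (S1 / 4)) (2 * (S1 / 4)) (by linarith) (by linarith); simpa using this)
    (by have := D (2 * (S1 / 4)) (3 * (S1 / 4)) (by linarith) (by linarith); simpa using this)
    (by have := D (3 * (S1 / 4)) (1 * (S1 / 4)) (by linarith) (by linarith); simpa using this)
    (by have := D (3 * (S1 / 4)) (2 * (S1 / 4)) (by linarith) (by linarith); simpa using this)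
    (by have := D (3 * (S1 / 4)) (3 * (S1 / 4)) (by linarith) (by linarith); simpa using this)
  have hB : S1 ^ 2 / 16 * (5 * g (1 * (S1 / 4)) + 3 * g (2 * (S1 / 4)) + g (3 * (S1 / 4)))
      - 2 * S1 * av b0 (ib w e c) ≤ av b0 (fun v => (dd w e v - m) ^ 2) := by
    simp only [hg]
    rw [← av_mul, ← av_mul, ← av_mul, ← av_add, ← av_add, ← av_mul, ← av_sub]
    refine av_mono' (hwk kB) fun v hv => ?_
    have hcv : c v = kB := by
      by_contra hh; apply hv; simp [ind, hh]
    exact core_half h hw c hcov hS10 hA (by linarith) v hcv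
  have hC : S1 ^ 2 / 16 * (5 * k (1 * (S1 / 4)) + 3 * k (2 * (S1 / 4)) + k (3 * (S1 / 4)))
      - 2 * S1 * av c0 (ib w e c) ≤ av c0 (fun v => (dd w e v - m) ^ 2) := by
    simp only [hk]
    rw [← av_mul, ← av_mul, ← av_mul, ← av_add, ← av_add, ← av_mul, ← av_sub]
    refine av_mono' (hwk kC) fun v hv => ?_
    have hcv : c v = kC := by
      by_contra hh; apply hv; simp [ind, hh]
    exact core_half h hw c (kA := kA) (fun k => by rcases hcov k with h | h | h <;> simp [h]) hS10 hA
      (by linarith) v hcv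
  have hsum : ∀ f : V → ℝ, (∀ v, 0 ≤ f v) → av b0 f + av c0 f ≤ av w f := by
    intro f hf
    rw [hb0, hc0, av_w_mul, av_w_mul, ← av_add]
    refine av_mono hw fun v => ?_
    have := hf v
    unfold ind
    split_ifs <;> first | (exfalso; simp_all; done) | linarith
  have h1 := hsum (ib w e c) (ib0 hw h c)
  have h2 := hsum (fun v => (dd w e v - m) ^ 2) (fun v => sq_nonneg _)
  have h3 : S1 ^ 2 / 16 * (19 * (S1 / 4) - 18 * (S / 50)) ≤ S1 ^ 2 / 16 * (5 * (g (1 * (S1 / 4)) + k (1 * (S1 / 4))) + 3 * (g (2 * (S1 / 4)) + k (2 * (S1 / 4))) + (g (3 * (S1 / 4)) + k (3 * (S1 / 4)))) :=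
    mul_le_mul_of_nonneg_left nine' (by positivity)
  have h4 : 2 * S1 * (av b0 (ib w e c) + av c0 (ib w e c)) ≤ 2 * S * (3 / 2 * S ^ 3) := by
    apply mul_le_mul (by linarith) (by linarith) _ (by linarith)
    exact add_nonneg (av_nonneg (hwk kB) (ib0 hw h c)) (av_nonneg (hwk kC) (ib0 hw h c))
  have h5 : S1 ^ 2 / 16 * (19 * (S1 / 4) - 18 * (S / 50)) ≥ (0.999 * S) ^ 2 / 16 * (4.38 * S) := by
    apply mul_le_mul _ (by linarith) (by positivity) (by positivity)
    have := pow_le_pow_left₀ (by positivity) hS1l 2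
    linarith
  have h6 : 0 < S ^ 3 := by positivity
  have h7 : 2 * S * (3 / 2 * S ^ 3) ≤ 3 / 10 ^ 8 * S ^ 3 := by nlinarith
  have h8 : (0.999 * S) ^ 2 / 16 * (4.38 * S) = 0.999 ^ 2 * 4.38 / 16 * S ^ 3 := by ring
  rw [h8] at h5
  have h9 : 0.27 * S ^ 3 ≤ 0.999 ^ 2 * 4.38 / 16 * S ^ 3 := by
    apply mul_le_mul_of_nonneg_right _ h6.le
    norm_num
  linarith

end FDFlb


namespace FDFlb
open Finset

variable {V : Type} [Fintype V] {e : V → V → ℝ}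

theorem tri_v (w : V → ℝ) (F G : V → V → ℝ) :
    (av w fun v => av w fun u => av w fun x => F v u * G v x) =
      av w fun v => av w (F v) * av w (G v) := by
  refine av_congr fun v => ?_
  rw [← av_mul_right]
  refine av_congr fun u => ?_
  rw [av_mul]

theorem tri_u (w : V → ℝ) (F G : V → V → ℝ) :
    (av w fun v => av w fun u => av w fun x => F u v * G u x) =
      av w fun v => av w (F v) * av w (G v) := by
  rw [av_comm, ← tri_v]

theorem tri_x (w : V → ℝ) (F G : V → V → ℝ) :
    (av w fun v => av w fun u => av w fun x => F x v * G x u) =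
      av w fun v => av w (F v) * av w (G v) := by
  rw [← tri_u w F G]
  refine av_congr fun v => ?_
  rw [av_comm]

theorem sm_symm (c : V → Fin 3) (u v : V) : sm c u v = sm c v u := by
  unfold sm; simp only [eq_comm]

theorem av_sm (w : V → ℝ) (c : V → Fin 3) (v : V) : av w (sm c v) = av w (ind c (c v)) := by
  refine av_congr fun u => ?_
  unfold sm ind; simp only [eq_comm]

theorem av_cls (w : V → ℝ) (c : V → Fin 3) (f : Fin 3 → ℝ) :
    av w (fun v => f (c v)) = av w (ind c 0) * f 0 + av w (ind c 1) * f 1 + av w (ind c 2) * f 2 := by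
  rw [← av_mul_right, ← av_mul_right, ← av_mul_right, ← av_add, ← av_add]
  refine av_congr fun v => ?_
  unfold ind
  generalize c v = k
  fin_cases k <;> simp

theorem nn_cls (w : V → ℝ) (c : V → Fin 3) (v : V) :
    nn w e v = av w (ind c (c v)) - ib w e c v + ob w e c v := by
  rw [← av_sm]; unfold ib ob nn
  rw [← av_sub, ← av_add]
  refine av_congr fun u => ?_
  rw [ad_eq]; ring

theorem sm_cases (c : V → Fin 3) (v u x : V) :
    (sm c v u = 1 ∧ sm c v x = 1 ∧ sm c u x = 1) ∨ (sm c v u = 1 ∧ sm c v x = 0 ∧ sm c u x = 0) ∨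
    (sm c v u = 0 ∧ sm c v x = 1 ∧ sm c u x = 0) ∨ (sm c v u = 0 ∧ sm c v x = 0 ∧ sm c u x = 1) ∨
    (sm c v u = 0 ∧ sm c v x = 0 ∧ sm c u x = 0) := by
  unfold sm
  by_cases h4 : c v = c u
  · rw [h4]; by_cases h5 : c u = c x <;> simp [h5]
  · by_cases h5 : c v = c x
    · rw [← h5]; simp [h4, Ne.symm h4]
    · by_cases h6 : c u = c x <;> simp [h4, h5, h6]

theorem K_ptw {a b d p q r : ℝ} (hs : (a = 1 ∧ b = 1 ∧ d = 1) ∨ (a = 1 ∧ b = 0 ∧ d = 0) ∨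
    (a = 0 ∧ b = 1 ∧ d = 0) ∨ (a = 0 ∧ b = 0 ∧ d = 1) ∨ (a = 0 ∧ b = 0 ∧ d = 0))
    (hp : p = 0 ∨ p = 1) (hq : q = 0 ∨ q = 1) (hr : r = 0 ∨ r = 1) :
    a * (d * (1 - r)) + a * ((1 - b) * q) + (1 - a) * p * b - a * (1 - p) * (d * (1 - r))
    - b * (1 - q) * (d * (1 - r)) - a * (1 - p) * ((1 - b) * q) - (1 - a) * p * (b * (1 - q))
    - (1 - b) * q * ((1 - d) * r) - (1 - a) * p * ((1 - d) * r) ≤ p * q * (1 - r) := by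
  rcases hs with ⟨rfl, rfl, rfl⟩ | ⟨rfl, rfl, rfl⟩ | ⟨rfl, rfl, rfl⟩ | ⟨rfl, rfl, rfl⟩ | ⟨rfl, rfl, rfl⟩ <;>
  rcases hp with rfl | rfl <;> rcases hq with rfl | rfl <;> rcases hr with rfl | rfl <;> norm_num

theorem K_low (h : OG e) {w : V → ℝ} (hw : ∀ v, 0 ≤ w v) (c : V → Fin 3) :
    av w (fun v => av w (ind c (c v)) * ib w e c v) + 2 * av w (fun v => av w (ind c (c v)) * ob w e c v)
      - 2 * av w (fun v => ib w e c v * ib w e c v) - 2 * av w (fun v => ib w e c v * ob w e c v)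
      - 2 * av w (fun v => ob w e c v * ob w e c v) ≤ KK w e := by
  simp only [← av_sm]
  set I : V → V → ℝ := fun v u => sm c v u * ad e v u with hI
  set O : V → V → ℝ := fun v u => (1 - sm c v u) * nb e v u with hO
  have hi : ∀ v, ib w e c v = av w (I v) := fun v => rfl
  have ho : ∀ v, ob w e c v = av w (O v) := fun v => rfl
  simp only [hi, ho]
  have e1 := tri_u w (sm c) I
  have e2 := tri_v w (sm c) O
  have e3 := tri_v w O (sm c)
  have e4 := tri_u w I I
  have e5 := tri_x w I I
  have e6 := tri_v w I O
  have e7 := tri_v w O I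
  have e8 := tri_x w O O
  have e9 := tri_u w O O
  have e3' : (av w fun v => av w (O v) * av w (sm c v)) = av w fun v => av w (sm c v) * av w (O v) :=
    av_congr fun v => mul_comm _ _
  have e7' : (av w fun v => av w (O v) * av w (I v)) = av w fun v => av w (I v) * av w (O v) :=
    av_congr fun v => mul_comm _ _
  have key : (av w fun v => av w fun u => av w fun x => (sm c u v * I u x + sm c v u * O v x
      + O v u * sm c v x - I u v * I u x - I x v * I x u - I v u * O v x - O v u * I v x
      - O x v * O x u - O u v * O u x : ℝ)) ≤ KK w e := by
    refine av_mono hw fun v => av_mono hw fun u => av_mono hw fun x => ?_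
    simp only [hI, hO, ad_eq]
    rw [nb_symm e u v, nb_symm e x v, nb_symm e x u]
    rw [sm_symm c u v, sm_symm c x v, sm_symm c x u]
    have := K_ptw (sm_cases c v u x) (h.nb01 v u) (h.nb01 v x) (h.nb01 u x)
    linarith
  simp only [av_add, av_sub] at key
  rw [e1, e2, e3, e4, e5, e6, e7, e8, e9, e3', e7'] at key
  linarith

end FDFlb


namespace FDFlb
open Finset

variable {V : Type} [Fintype V] {e : V → V → ℝ}

theorem av_dd {w : V → ℝ} (h1 : av w (fun _ => 1) = 1) :
    av w (dd w e) = (1 - av w (nn w e)) / 2 := by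
  have : av w (nn w e) = 1 - av w (dd w e) - av w (dd w e) := by
    unfold nn nb dd
    have : (av w fun v => av w fun u => e v u) = av w fun v => av w fun u => e u v := by
      rw [av_comm]
    conv_rhs => arg 2; rw [this]
    simp only [av_sub, h1]
  linarith

set_option maxHeartbeats 1000000 in
theorem PP_low (h : OG e) {w : V → ℝ} (hw : ∀ v, 0 ≤ w v) (h1 : av w (fun _ => 1) = 1) (c : V → Fin 3)
    (ha : ∀ k, |av w (ind c k) - 1 / 3| ≤ 1 / 10 ^ 9)
    (hbad : ∀ v, w v ≠ 0 → ib w e c v + ob w e c v ≤ 1 / 100) {a0 a1 a2 q bi bo m : ℝ}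
    (h0 : a0 = av w (ind c 0)) (h1' : a1 = av w (ind c 1)) (h2 : a2 = av w (ind c 2))
    (hq : q = a0 * a1 + a1 * a2 + a0 * a2) (hbi : bi = av w (ib w e c)) (hbo : bo = av w (ob w e c))
    (hm : m = av w (dd w e)) :
    a0 + a1 + a2 = 1 ∧ m = q + (bi - bo) / 2 ∧
    3 * av w (fun v => (dd w e v - m) ^ 2) + (bi + bo) / 2 + 3 * q ^ 2 + a0 ^ 3 + a1 ^ 3 + a2 ^ 3 ≤ PP w e := by
  have hbi0 : 0 ≤ bi := by rw [hbi]; exact av_nonneg hw (ib0 hw h c)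
  have hbo0 : 0 ≤ bo := by rw [hbo]; exact av_nonneg hw (ob0 hw h c)
  have hsum : a0 + a1 + a2 = 1 := by
    have := av_cls w c (fun _ => 1)
    rw [h1] at this; linarith
  have hnn : av w (nn w e) = a0 ^ 2 + a1 ^ 2 + a2 ^ 2 - bi + bo := by
    have : av w (nn w e) = av w (fun v => av w (ind c (c v))) - av w (ib w e c) + av w (ob w e c) := by
      rw [← av_sub, ← av_add]; exact av_congr fun v => nn_cls w c v
    rw [this, av_cls w c (fun k => av w (ind c k)), ← h0, ← h1', ← h2, ← hbi, ← hbo]; ring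
  have hmq : m = q + (bi - bo) / 2 := by
    rw [hm, av_dd h1, hnn, hq]
    have : a2 = 1 - a0 - a1 := by linarith
    rw [this]; ring
  refine ⟨hsum, hmq, ?_⟩
  have hK := K_low h hw c
  have hsq : av w (fun v => (dd w e v - m) ^ 2) = av w (fun v => dd w e v ^ 2) - m ^ 2 := by
    rw [av_sq hw h1, ← hm]; ring
  have ha3 : av w (fun v => av w (ind c (c v)) ^ 2) = a0 ^ 3 + a1 ^ 3 + a2 ^ 3 := by
    rw [av_cls w c (fun k => av w (ind c k) ^ 2), ← h0, ← h1', ← h2]; ring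
  have hmain : av w (fun v => av w (ind c (c v)) ^ 2) + (2 - 6 / 10 ^ 9) * bo - 4 / 100 * (bi + bo)
      ≤ av w (fun v => nn w e v ^ 2) + 2 * (av w (fun v => av w (ind c (c v)) * ib w e c v) + 2 * av w (fun v => av w (ind c (c v)) * ob w e c v)
      - 2 * av w (fun v => ib w e c v * ib w e c v) - 2 * av w (fun v => ib w e c v * ob w e c v)
      - 2 * av w (fun v => ob w e c v * ob w e c v)) := by
    rw [hbi, hbo]
    simp only [← av_mul, ← av_add, ← av_sub]
    refine av_mono' hw fun v hv => ?_
    have hb := hbad v hv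
    have hi := ib0 hw h c v
    have ho := ob0 hw h c v
    have ha' := (abs_le.1 (ha (c v))).1
    rw [nn_cls w c v]
    generalize ib w e c v = i at *
    generalize ob w e c v = o at *
    generalize av w (ind c (c v)) = a at *
    nlinarith [sq_nonneg (o - i), mul_nonneg hi (sub_nonneg.2 hb), mul_nonneg ho (sub_nonneg.2 hb),
      mul_nonneg ho (show 0 ≤ a - (1 / 3 - 1 / 10 ^ 9) by linarith), mul_nonneg hi ho]
  have hqb : 0.33 ≤ q ∧ q ≤ 1 / 3 := by
    have b0 := abs_le.1 (ha 0); have b1 := abs_le.1 (ha 1); have b2 := abs_le.1 (ha 2)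
    rw [← h0] at b0; rw [← h1'] at b1; rw [← h2] at b2
    rw [hq]
    constructor
    · have p1 : 0.333 * 0.333 ≤ a0 * a1 := mul_le_mul (by linarith) (by linarith) (by norm_num) (by linarith)
      have p2 : 0.333 * 0.333 ≤ a1 * a2 := mul_le_mul (by linarith) (by linarith) (by norm_num) (by linarith)
      have p3 : 0.333 * 0.333 ≤ a0 * a2 := mul_le_mul (by linarith) (by linarith) (by norm_num) (by linarith)
      linarith
    · have : a2 = 1 - a0 - a1 := by linarith
      rw [this]; nlinarith [sq_nonneg (a0 - a1), sq_nonneg (a0 + a1 - 2 / 3)]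
  unfold PP
  have hm2 : q ^ 2 + q * (bi - bo) ≤ m ^ 2 := by
    have : m ^ 2 = q ^ 2 + q * (bi - bo) + ((bi - bo) / 2) ^ 2 := by rw [hmq]; ring
    linarith [sq_nonneg ((bi - bo) / 2)]
  have h4 : 0.99 * bi - bo ≤ 3 * (q * (bi - bo)) := by nlinarith [hqb.1, hqb.2]
  rw [hsq]
  linarith

theorem tripart_aux (h : OG e) {w : V → ℝ} (hw : ∀ v, 0 ≤ w v)
    (c : V → Fin 3) {kA kB kC : Fin 3} (hBC : kB ≠ kC)
    (hcov : ∀ k, k = kA ∨ k = kB ∨ k = kC) {ε x y z q bi bo m : ℝ} (hε : 0 < ε)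
    (ha : ∀ k, |av w (ind c k) - 1 / 3| ≤ 1 / 10 ^ 9)
    (hC4 : av w (HH e w w) ≤ ε ^ 2 / 10 ^ 12)
    (h0 : x = av w (ind c kA)) (h1' : y = av w (ind c kB)) (h2 : z = av w (ind c kC))
    (hbi : bi = av w (ib w e c)) (hbo : bo = av w (ob w e c))
    (hs : x + y + z = 1) (hq : q = x * y + y * z + x * z)
    (hm : m = q + (bi - bo) / 2)
    (hx : x < 1 / 3) (hy : 1 / 3 ≤ y) (hz : 1 / 3 ≤ z)
    (hlt : 3 * av w (fun v => (dd w e v - m) ^ 2) + (bi + bo) / 2 + 3 * q ^ 2 + x ^ 3 + y ^ 3 + z ^ 3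
      < 4 / 9 - ε) : False := by
  obtain ⟨S, hS⟩ : ∃ S, S = 1 / 3 - x := ⟨_, rfl⟩
  obtain ⟨r, hr⟩ : ∃ r, r = y - 1 / 3 := ⟨_, rfl⟩
  have hS0 : 0 < S := by linarith
  have hr0 : 0 ≤ r := by linarith
  have hrS : r ≤ S := by linarith
  have hxx : x = 1 / 3 - S := by linarith
  have hyy : y = 1 / 3 + r := by linarith
  have hzz : z = 1 / 3 + (S - r) := by linarith
  have hS9 : S ≤ 1 / 10 ^ 9 := by
    have := (abs_le.1 (ha kA)).1; rw [← h0] at this; linarith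
  have hbi0 : 0 ≤ bi := by rw [hbi]; exact av_nonneg hw (ib0 hw h c)
  have hbo0 : 0 ≤ bo := by rw [hbo]; exact av_nonneg hw (ob0 hw h c)
  have hV0 : 0 ≤ av w (fun v => (dd w e v - m) ^ 2) := av_nonneg hw fun v => sq_nonneg _
  have hP : 4 / 9 - 3 / 4 * S ^ 3 ≤ 3 * q ^ 2 + x ^ 3 + y ^ 3 + z ^ 3 := by
    have e1 : 3 * q ^ 2 + x ^ 3 + y ^ 3 + z ^ 3 = 4 / 9 + 3 / 4 * (S ^ 2 + r ^ 2 + (S - r) ^ 2) ^ 2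
        - 3 * S * (r * (S - r)) := by
      rw [hq, hxx, hyy, hzz]; ring
    have e2 : r * (S - r) ≤ S ^ 2 / 4 := by nlinarith [sq_nonneg (S - 2 * r)]
    have e3 : S * (r * (S - r)) ≤ S * (S ^ 2 / 4) := mul_le_mul_of_nonneg_left e2 hS0.le
    rw [e1]
    nlinarith [sq_nonneg (S ^ 2 + r ^ 2 + (S - r) ^ 2)]
  have hSe : ε ≤ S ^ 3 := by
    have : 0 < S ^ 3 := by positivity
    linarith
  have hS6 : ε ^ 2 ≤ S ^ 4 := by
    have : ε ^ 2 ≤ (S ^ 3) ^ 2 := pow_le_pow_left₀ hε.le hSe 2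
    have h6 : S ^ 6 ≤ S ^ 4 := pow_le_pow_of_le_one hS0.le (by linarith) (by norm_num)
    nlinarith
  refine core h hw c (kA := kA) (kB := kB) (kC := kC) hBC hcov (S := S) (m := m) hS0 (by linarith)
    (by rw [← hbi, ← hbo]; linarith) (by linarith) ?_ (by linarith) (by linarith) ?_ (by linarith)
  · calc _ ≤ _ := hC4
      _ ≤ S ^ 4 / 10 ^ 12 := by linarith
      _ = _ := by ring
  · have e1 : q = 1 / 3 - (S ^ 2 - r * (S - r)) := by rw [hq, hxx, hyy, hzz]; ring
    have : 0 ≤ r * (S - r) := mul_nonneg hr0 (by linarith)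
    linarith

theorem tripart (h : OG e) {w : V → ℝ} (hw : ∀ v, 0 ≤ w v) (h1 : av w (fun _ => 1) = 1) (c : V → Fin 3)
    (ha : ∀ k, |av w (ind c k) - 1 / 3| ≤ 1 / 10 ^ 9)
    (hbad : ∀ v, w v ≠ 0 → ib w e c v + ob w e c v ≤ 1 / 100) {ε : ℝ} (hε : 0 < ε)
    (hC4 : av w (HH e w w) ≤ ε ^ 2 / 10 ^ 12) : 4 / 9 - ε ≤ PP w e := by
  by_contra hcon
  push Not at hcon
  obtain ⟨x, hx⟩ : ∃ x, x = av w (ind c 0) := ⟨_, rfl⟩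
  obtain ⟨y, hy⟩ : ∃ x, x = av w (ind c 1) := ⟨_, rfl⟩
  obtain ⟨z, hz⟩ : ∃ x, x = av w (ind c 2) := ⟨_, rfl⟩
  obtain ⟨q, hq⟩ : ∃ q, q = x * y + y * z + x * z := ⟨_, rfl⟩
  obtain ⟨bi, hbi⟩ : ∃ x, x = av w (ib w e c) := ⟨_, rfl⟩
  obtain ⟨bo, hbo⟩ : ∃ x, x = av w (ob w e c) := ⟨_, rfl⟩
  obtain ⟨m, hm⟩ : ∃ x, x = av w (dd w e) := ⟨_, rfl⟩
  obtain ⟨hs, hmq, hlow⟩ := PP_low h hw h1 c ha hbad hx hy hz hq hbi hbo hm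
  have hlt := lt_of_le_of_lt hlow hcon
  have hbi0 : 0 ≤ bi := by rw [hbi]; exact av_nonneg hw (ib0 hw h c)
  have hbo0 : 0 ≤ bo := by rw [hbo]; exact av_nonneg hw (ob0 hw h c)
  have hV0 : 0 ≤ av w (fun v => (dd w e v - m) ^ 2) := av_nonneg hw fun v => sq_nonneg _
  -- product of the deviations is negative
  have hprod : (x - 1 / 3) * (y - 1 / 3) * (z - 1 / 3) < 0 := by
    by_contra hp
    push Not at hp
    have e1 : 3 * q ^ 2 + x ^ 3 + y ^ 3 + z ^ 3 = 4 / 9 + 3 / 4 * ((x - 1 / 3) ^ 2 + (y - 1 / 3) ^ 2 + (z - 1 / 3) ^ 2) ^ 2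
        + 3 * ((x - 1 / 3) * (y - 1 / 3) * (z - 1 / 3)) := by
      have : z = 1 - x - y := by linarith
      rw [hq, this]; ring
    nlinarith [sq_nonneg ((x - 1 / 3) ^ 2 + (y - 1 / 3) ^ 2 + (z - 1 / 3) ^ 2)]
  by_cases cx : x < 1 / 3
  · have hyz : 0 < (y - 1 / 3) * (z - 1 / 3) := by nlinarith
    have hy' : 1 / 3 ≤ y := by nlinarith
    have hz' : 1 / 3 ≤ z := by nlinarith
    exact tripart_aux h hw c (kA := 0) (kB := 1) (kC := 2) (by decide) (by decide) hε ha hC4 hx hy hz hbi hbo hs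
      hq hmq cx hy' hz' hlt
  · push Not at cx
    have hyz : (y - 1 / 3) * (z - 1 / 3) < 0 := by
      by_contra hn; push Not at hn
      nlinarith [mul_nonneg (sub_nonneg.2 cx) hn]
    by_cases cy : y < 1 / 3
    · have hz' : 1 / 3 ≤ z := by nlinarith
      exact tripart_aux h hw c (kA := 1) (kB := 0) (kC := 2) (x := y) (y := x) (z := z) (q := q) (m := m)
        (by decide) (by decide) hε ha hC4 hy hx hz hbi hbo
        (by linarith) (by rw [hq]; ring) hmq cy cx hz' (by linarith)
    · push Not at cy
      have hz' : z < 1 / 3 := by nlinarith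
      exact tripart_aux h hw c (kA := 2) (kB := 0) (kC := 1) (x := z) (y := x) (z := y) (q := q) (m := m)
        (by decide) (by decide) hε ha hC4 hz hx hy hbi hbo
        (by linarith) (by rw [hq]; ring) hmq hz' cx cy (by linarith)

end FDFlb


namespace FDFlb
open Finset

variable {V : Type} [Fintype V] {e : V → V → ℝ}

/-- indicator of a hyperedge -/
def hh (e : V → V → ℝ) (u v x : V) : ℝ :=
  e u v * e u x + e v u * e v x + e x u * e x v + (nb e u v * nb e u x + nb e v u * nb e v x
    + nb e x u * nb e x v - 2 * (nb e u v * nb e u x * nb e v x))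

theorem hh_swap (e : V → V → ℝ) (u v x : V) : hh e u v x = hh e v u x := by
  unfold hh; rw [nb_symm e v u, nb_symm e x u, nb_symm e x v]; ring
theorem hh_swap' (e : V → V → ℝ) (u v x : V) : hh e u v x = hh e u x v := by
  unfold hh; rw [nb_symm e v u, nb_symm e x u, nb_symm e x v]; ring

theorem hh01 (h : OG e) (u v x : V) : hh e u v x = 0 ∨ hh e u v x = 1 := by
  unfold hh nb
  rcases h.cases u v with ⟨a1, a2⟩ | ⟨a1, a2⟩ | ⟨a1, a2⟩ <;>
  rcases h.cases u x with ⟨b1, b2⟩ | ⟨b1, b2⟩ | ⟨b1, b2⟩ <;>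
  rcases h.cases v x with ⟨c1, c2⟩ | ⟨c1, c2⟩ | ⟨c1, c2⟩ <;>
  rw [a1, a2, b1, b2, c1, c2] <;> norm_num

theorem PP_eq (w : V → ℝ) (e : V → V → ℝ) :
    PP w e = av w fun u => av w fun v => av w fun x => hh e u v x := by
  have hK : (av w fun v => av w fun u => av w fun x => nb e v u * nb e v x * nb e u x) =
      av w (fun v => nn w e v * nn w e v) - KK w e := by
    unfold KK nn
    rw [← tri_v w (fun v u => nb e v u) (fun v u => nb e v u)]
    simp only [← av_sub]
    refine av_congr fun v => av_congr fun u => av_congr fun x => ?_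
    rw [ad_eq]; ring
  have e1 := tri_v w e e
  have e2 := tri_u w e e
  have e3 := tri_x w e e
  have e4 := tri_v w (nb e) (nb e)
  have e5 := tri_u w (nb e) (nb e)
  have e6 := tri_x w (nb e) (nb e)
  have : ∀ u v x, hh e u v x = e u v * e u x + e v u * e v x + e x u * e x v + nb e u v * nb e u x + nb e v u * nb e v x
    + nb e x u * nb e x v - nb e u v * nb e u x * nb e v x - nb e u v * nb e u x * nb e v x := by
    intro u v x; unfold hh; ring
  simp only [this]
  simp only [av_add, av_sub]
  rw [e1, e2, e3, e4, e5, e6, hK]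
  have f1 : av w (fun v => dd w e v ^ 2) = av w fun v => av w (e v) * av w (e v) :=
    av_congr fun v => by unfold dd; ring
  have f2 : av w (fun v => nn w e v ^ 2) = av w fun v => av w (nb e v) * av w (nb e v) :=
    av_congr fun v => by unfold nn; ring
  have f3 : av w (fun v => nn w e v * nn w e v) = av w fun v => av w (nb e v) * av w (nb e v) :=
    av_congr fun v => by unfold nn; ring
  unfold PP
  rw [f1, f2, f3]; ring

/-- link density -/
noncomputable def lk (w : V → ℝ) (e : V → V → ℝ) (v : V) : ℝ :=
  av w fun u => av w fun x => hh e v u x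

theorem PP_del (h : OG e) {w : V → ℝ} (hw : ∀ v, 0 ≤ w v) (h1 : av w (fun _ => 1) = 1)
    {ξ : V → ℝ} (hξ : ∀ v, ξ v = 0 ∨ ξ v = 1) :
    PP (fun v => w v * (1 - ξ v)) e + 3 * av w (fun v => ξ v * lk w e v) - 3 * (av w ξ) ^ 2 ≤ PP w e := by
  rw [PP_eq, PP_eq]
  simp only [av_w_mul]
  have e1 : av w (fun v => ξ v * lk w e v) = av w fun u => av w fun v => av w fun x => ξ u * hh e u v x := by
    unfold lk; simp only [av_mul]
  have e2 : av w (fun v => ξ v * lk w e v) = av w fun u => av w fun v => av w fun x => ξ v * hh e u v x := by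
    rw [e1, av_comm]; refine av_congr fun u => av_congr fun v => av_congr fun x => ?_
    rw [hh_swap]
  have e3 : av w (fun v => ξ v * lk w e v) = av w fun u => av w fun v => av w fun x => ξ x * hh e u v x := by
    rw [e2]; refine av_congr fun u => ?_
    rw [av_comm]; refine av_congr fun v => av_congr fun x => ?_
    rw [hh_swap']
  have t1 : (av w fun u => av w fun v => av w fun x => ξ u * ξ v) = av w ξ ^ 2 := by
    have : ∀ c, (av w fun _ => c) = c := fun c => by rw [av_const, h1, mul_one]
    simp only [this, av_mul, av_mul_right]; ring
  have t2 : (av w fun u => av w fun v => av w fun x => ξ u * ξ x) = av w ξ ^ 2 := by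
    have : ∀ c, (av w fun _ => c) = c := fun c => by rw [av_const, h1, mul_one]
    simp only [this, av_mul, av_mul_right]; ring
  have t3 : (av w fun u => av w fun v => av w fun x => ξ v * ξ x) = av w ξ ^ 2 := by
    have : ∀ c, (av w fun _ => c) = c := fun c => by rw [av_const, h1, mul_one]
    simp only [this, av_mul, av_mul_right]; ring
  have key : (av w fun u => av w fun v => av w fun x => ((1 - ξ u) * ((1 - ξ v) * ((1 - ξ x) * hh e u v x))
     + ξ u * hh e u v x + ξ v * hh e u v x + ξ x * hh e u v x - ξ u * ξ v - ξ u * ξ x - ξ v * ξ x)) ≤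
      av w fun u => av w fun v => av w fun x => hh e u v x := by
    refine av_mono hw fun u => av_mono hw fun v => av_mono hw fun x => ?_
    rcases hh01 h u v x with a | a <;> rcases hξ u with b | b <;> rcases hξ v with c | c <;>
      rcases hξ x with d | d <;> rw [a, b, c, d] <;> norm_num
  have key2 : (av w fun u => av w fun v => av w fun x => ((1 - ξ u) * ((1 - ξ v) * ((1 - ξ x) * hh e u v x))
     + ξ u * hh e u v x + ξ v * hh e u v x + ξ x * hh e u v x - ξ u * ξ v - ξ u * ξ x - ξ v * ξ x)) =
     (av w fun u => av w fun v => av w fun x => (1 - ξ u) * ((1 - ξ v) * ((1 - ξ x) * hh e u v x)))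
      + (av w fun u => av w fun v => av w fun x => ξ u * hh e u v x)
      + (av w fun u => av w fun v => av w fun x => ξ v * hh e u v x)
      + (av w fun u => av w fun v => av w fun x => ξ x * hh e u v x)
      - (av w fun u => av w fun v => av w fun x => ξ u * ξ v)
      - (av w fun u => av w fun v => av w fun x => ξ u * ξ x)
      - (av w fun u => av w fun v => av w fun x => ξ v * ξ x) := by
    simp only [← av_add, ← av_sub]
  rw [key2, ← e1, ← e2, ← e3, t1, t2, t3] at key
  have e4 : (av w fun v => (1 - ξ v) * av w fun v_1 => (1 - ξ v_1) * av w fun v_2 => (1 - ξ v_2) * hh e v v_1 v_2)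
    = av w fun u => av w fun v => av w fun x => (1 - ξ u) * ((1 - ξ v) * ((1 - ξ x) * hh e u v x)) := by
    simp only [av_mul]
  rw [e4]; linarith

theorem PP_scale (w : V → ℝ) (e : V → V → ℝ) (r : ℝ) : PP (fun v => w v * r) e = r ^ 3 * PP w e := by
  rw [PP_eq, PP_eq]
  simp only [av_w_mul _ (fun _ => r), av_mul]
  ring

theorem HH_scale (w : V → ℝ) (e : V → V → ℝ) (r : ℝ) :
    av (fun v => w v * r) (HH e (fun v => w v * r) (fun v => w v * r)) = r ^ 4 * av w (HH e w w) := by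
  unfold HH
  simp only [av_w_mul _ (fun _ => r), av_mul]
  ring

end FDFlb


namespace FDFlb
open Finset

variable {V : Type} [Fintype V] {e : V → V → ℝ}

theorem exists_pos_of_av {w : V → ℝ} (hw : ∀ v, 0 ≤ w v) {f : V → ℝ} (h : 0 < av w f) : ∃ v, 0 < f v := by
  by_contra hc
  push Not at hc
  have := av_nonneg hw (f := fun v => - f v) (fun v => by linarith [hc v])
  rw [av_neg] at this
  linarith

/-- common non-neighbours -/
noncomputable def ov (w : V → ℝ) (e : V → V → ℝ) (v t : V) : ℝ := av w fun u => nb e v u * nb e t u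
/-- distance -/
noncomputable def ds (w : V → ℝ) (e : V → V → ℝ) (v t : V) : ℝ := av w fun u => |nb e v u - nb e t u|
/-- mean distance -/
noncomputable def Dt (w : V → ℝ) (e : V → V → ℝ) (t : V) : ℝ := av w fun v => nb e t v * ds w e v t

theorem ds0 {w : V → ℝ} (hw : ∀ v, 0 ≤ w v) (v t : V) : 0 ≤ ds w e v t := av_nonneg hw fun _ => abs_nonneg _
theorem ov0 (h : OG e) {w : V → ℝ} (hw : ∀ v, 0 ≤ w v) (v t : V) : 0 ≤ ov w e v t :=
  av_nonneg hw fun _ => mul_nonneg (h.nb0 _ _) (h.nb0 _ _)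
theorem Dt0 (h : OG e) {w : V → ℝ} (hw : ∀ v, 0 ≤ w v) (t : V) : 0 ≤ Dt w e t :=
  av_nonneg hw fun _ => mul_nonneg (h.nb0 _ _) (ds0 hw _ _)

theorem abs_ptw (h : OG e) (v t u : V) :
    |nb e v u - nb e t u| = nb e v u + nb e t u - 2 * (nb e v u * nb e t u) := by
  rcases h.nb01 v u with a | a <;> rcases h.nb01 t u with b | b <;> rw [a, b] <;> norm_num

theorem ds_eq (h : OG e) (w : V → ℝ) (v t : V) : ds w e v t = nn w e v + nn w e t - 2 * ov w e v t := by
  unfold ds nn ov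
  rw [← av_mul, ← av_add, ← av_sub]
  exact av_congr fun u => abs_ptw h v t u

theorem ds_tri {w : V → ℝ} (hw : ∀ v, 0 ≤ w v) (u a b : V) : ds w e a b ≤ ds w e u a + ds w e u b := by
  unfold ds
  rw [← av_add]
  refine av_mono hw fun x => ?_
  have := abs_sub_le (nb e a x) (nb e u x) (nb e b x)
  rw [abs_sub_comm (nb e a x) (nb e u x)] at this
  exact this

theorem triple_nb (w : V → ℝ) (e : V → V → ℝ) :
    (av w fun v => av w fun u => av w fun x => nb e v u * nb e v x * nb e u x) =
      av w (fun v => nn w e v * nn w e v) - KK w e := by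
  unfold KK nn
  rw [← tri_v w (fun v u => nb e v u) (fun v u => nb e v u)]
  simp only [← av_sub]
  refine av_congr fun v => av_congr fun u => av_congr fun x => ?_
  rw [ad_eq]; ring

theorem av_Dt (h : OG e) (w : V → ℝ) : av w (Dt w e) = 2 * KK w e := by
  have e0 := triple_nb w e
  have e4 := tri_v w (nb e) (nb e)
  have e5 := tri_u w (nb e) (nb e)
  have f3 : av w (fun v => nn w e v * nn w e v) = av w fun v => av w (nb e v) * av w (nb e v) := rfl
  have : av w (Dt w e) = (av w fun v => av w fun u => av w fun x => nb e u v * nb e u x) +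
      (av w fun v => av w fun u => av w fun x => nb e v u * nb e v x) -
      (av w fun v => av w fun u => av w fun x => nb e v u * nb e v x * nb e u x) -
      (av w fun v => av w fun u => av w fun x => nb e v u * nb e v x * nb e u x) := by
    unfold Dt ds
    simp only [← av_add, ← av_sub, ← av_mul]
    refine av_congr fun v => av_congr fun u => av_congr fun x => ?_
    rw [abs_ptw h, nb_symm e u v]; ring
  rw [this, e4, e5, e0, f3]; ring

theorem av_adov (w : V → ℝ) (e : V → V → ℝ) :
    (av w fun x => av w fun y => ad e x y * ov w e x y) = KK w e := by
  have e0 := triple_nb w e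
  have e6 := tri_x w (nb e) (nb e)
  have f3 : av w (fun v => nn w e v * nn w e v) = av w fun v => av w (nb e v) * av w (nb e v) := rfl
  have : (av w fun x => av w fun y => ad e x y * ov w e x y) =
      (av w fun v => av w fun u => av w fun x => nb e x v * nb e x u) -
      (av w fun v => av w fun u => av w fun x => nb e v u * nb e v x * nb e u x) := by
    unfold ov
    simp only [← av_sub, ← av_mul]
    refine av_congr fun v => av_congr fun u => av_congr fun x => ?_
    rw [ad_eq, nb_symm e x v, nb_symm e x u]; ring
  rw [this, e6, e0, f3]; ring

theorem tri_dens {w : V → ℝ} (h1 : av w (fun _ => 1) = 1) (e : V → V → ℝ) :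
    (av w fun v => av w fun u => av w fun x => ad e v u * ad e v x * ad e u x) =
      1 - 3 * av w (nn w e) + 2 * av w (fun v => nn w e v * nn w e v) + KK w e := by
  have hc : ∀ c, (av w fun _ => c) = c := fun c => by rw [av_const, h1, mul_one]
  have e0 := triple_nb w e
  have e4 := tri_v w (nb e) (nb e)
  have e5 := tri_u w (nb e) (nb e)
  have e6 := tri_x w (nb e) (nb e)
  have f3 : av w (fun v => nn w e v * nn w e v) = av w fun v => av w (nb e v) * av w (nb e v) := rfl
  have a1 : (av w fun v => av w fun u => av w fun x => nb e v u) = av w (nn w e) := by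
    simp only [hc]; rfl
  have a2 : (av w fun v => av w fun u => av w fun x => nb e v x) = av w (nn w e) := by
    simp only [hc]; rfl
  have a3 : (av w fun v => av w fun u => av w fun x => nb e u x) = av w (nn w e) := by
    simp only [hc]; rfl
  have a0 : (av w fun v => av w fun u => av w fun x => (1 : ℝ)) = 1 := by simp only [hc]
  have : (av w fun v => av w fun u => av w fun x => ad e v u * ad e v x * ad e u x) =
      (av w fun v => av w fun u => av w fun x => (1:ℝ)) -
      (av w fun v => av w fun u => av w fun x => nb e v u) -
      (av w fun v => av w fun u => av w fun x => nb e v x) -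
      (av w fun v => av w fun u => av w fun x => nb e u x) +
      (av w fun v => av w fun u => av w fun x => nb e v u * nb e v x) +
      (av w fun v => av w fun u => av w fun x => nb e u v * nb e u x) +
      (av w fun v => av w fun u => av w fun x => nb e x v * nb e x u) -
      (av w fun v => av w fun u => av w fun x => nb e v u * nb e v x * nb e u x) := by
    simp only [← av_sub, ← av_add]
    refine av_congr fun v => av_congr fun u => av_congr fun x => ?_
    rw [ad_eq, ad_eq, ad_eq, nb_symm e x v, nb_symm e x u, nb_symm e u v]; ring
  rw [this, a0, a1, a2, a3, e4, e5, e6, e0, f3]; ring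

theorem exists_tri (h : OG e) {w : V → ℝ} (hw : ∀ v, 0 ≤ w v) (h1 : av w (fun _ => 1) = 1) {η : ℝ}
    (hη : 0 < η) (hK : KK w e ≤ η / 6) (hV : av w (fun v => (nn w e v - 1 / 3) ^ 2) ≤ η)
    (hT : 1 / 5 ≤ 1 - 3 * av w (nn w e) + 2 * av w (fun v => nn w e v * nn w e v) + KK w e) :
    ∃ x y z, ad e x y = 1 ∧ ad e x z = 1 ∧ ad e y z = 1 ∧
      (Dt w e x + (nn w e x - 1 / 3) ^ 2) + (Dt w e y + (nn w e y - 1 / 3) ^ 2) +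
      (Dt w e z + (nn w e z - 1 / 3) ^ 2) + ov w e x y + ov w e x z + ov w e y z ≤ 23 * η := by
  have hc : ∀ c, (av w fun _ => c) = c := fun c => by rw [av_const, h1, mul_one]
  set p : V → ℝ := fun v => Dt w e v + (nn w e v - 1 / 3) ^ 2 with hp
  have hp0 : ∀ v, 0 ≤ p v := fun v => add_nonneg (Dt0 h hw v) (sq_nonneg _)
  have hpa : av w p ≤ 4 / 3 * η := by
    rw [hp, av_add, show (av w fun v => Dt w e v) = av w (Dt w e) from rfl, av_Dt h]; linarith
  set A : V → V → ℝ := fun x y => ad e x y * ov w e x y with hA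
  have hA0 : ∀ x y, 0 ≤ A x y := fun x y => mul_nonneg (h.ad0 _ _) (ov0 h hw _ _)
  have hAa : (av w fun x => av w fun y => A x y) = KK w e := av_adov w e
  have q : (av w fun x => av w fun y => av w fun z => (ad e x y * ad e x z * ad e y z * (23 * η)
      - p x - p y - p z - A x y - A x z - A y z)) =
      (av w fun v => av w fun u => av w fun x => ad e v u * ad e v x * ad e u x) * (23 * η)
      - av w p - av w p - av w p - KK w e - KK w e - KK w e := by
    simp only [av_sub, hc, av_mul_right]
    rw [hAa]
  have hpos : 0 < av w fun x => av w fun y => av w fun z => (ad e x y * ad e x z * ad e y z * (23 * η)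
      - p x - p y - p z - A x y - A x z - A y z) := by
    rw [q, tri_dens h1]
    have := mul_le_mul_of_nonneg_right hT (show 0 ≤ 23 * η by linarith)
    linarith
  obtain ⟨x, hx⟩ := exists_pos_of_av hw hpos
  obtain ⟨y, hy⟩ := exists_pos_of_av hw hx
  obtain ⟨z, hz⟩ := exists_pos_of_av hw hy
  have := hp0 x; have := hp0 y; have := hp0 z
  have := hA0 x y; have := hA0 x z; have := hA0 y z
  refine ⟨x, y, z, ?_⟩
  have hxy : ad e x y = 1 := by
    rcases h.ad01 x y with a | a
    · rw [a] at hz; linarith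
    · exact a
  have hxz : ad e x z = 1 := by
    rcases h.ad01 x z with a | a
    · rw [a] at hz; linarith
    · exact a
  have hyz : ad e y z = 1 := by
    rcases h.ad01 y z with a | a
    · rw [a] at hz; linarith
    · exact a
  refine ⟨hxy, hxz, hyz, ?_⟩
  simp only [hA, hxy, hxz, hyz, hp, one_mul] at hz
  linarith

end FDFlb


namespace FDFlb
open Finset

variable {V : Type} [Fintype V] {e : V → V → ℝ}

/-- good triangle -/
structure Tr (w : V → ℝ) (e : V → V → ℝ) (t : Fin 3 → V) (s : ℝ) : Prop where
  hs : 0 < s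
  hs' : s ≤ 1 / 10 ^ 11
  hn : ∀ k, |nn w e (t k) - 1 / 3| ≤ s
  hD : ∀ k, Dt w e (t k) ≤ s ^ 2
  o01 : ov w e (t 0) (t 1) ≤ s ^ 2
  o02 : ov w e (t 0) (t 2) ≤ s ^ 2
  o12 : ov w e (t 1) (t 2) ≤ s ^ 2

/-- uncovered -/
def unc (e : V → V → ℝ) (t : Fin 3 → V) (u : V) : ℝ :=
  (1 - nb e (t 0) u) * (1 - nb e (t 1) u) * (1 - nb e (t 2) u)

/-- far non-neighbour -/
noncomputable def far (w : V → ℝ) (e : V → V → ℝ) (t : Fin 3 → V) (k : Fin 3) (u : V) : ℝ :=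
  nb e (t k) u * (if ds w e u (t k) ≤ 1 / 200 then 0 else 1)

/-- exceptional -/
noncomputable def ex (w : V → ℝ) (e : V → V → ℝ) (t : Fin 3 → V) (u : V) : ℝ :=
  unc e t u + far w e t 0 u + far w e t 1 u + far w e t 2 u

/-- colour -/
noncomputable def col (w : V → ℝ) (e : V → V → ℝ) (t : Fin 3 → V) (u : V) : Fin 3 :=
  if ds w e u (t 0) ≤ 1 / 200 then 0 else if ds w e u (t 1) ≤ 1 / 200 then 1 else 2

/-- far from all -/
noncomputable def xi (w : V → ℝ) (e : V → V → ℝ) (t : Fin 3 → V) (u : V) : ℝ :=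
  if ds w e u (t 0) ≤ 1 / 200 then 0 else if ds w e u (t 1) ≤ 1 / 200 then 0 else
  if ds w e u (t 2) ≤ 1 / 200 then 0 else 1

theorem unc_le {w : V → ℝ} (h : OG e) (hw : ∀ v, 0 ≤ w v) (h1 : av w (fun _ => 1) = 1) {t : Fin 3 → V} {s : ℝ}
    (T : Tr w e t s) : av w (unc e t) ≤ 3 * s + 3 * s ^ 2 := by
  have : av w (unc e t) ≤ av w (fun _ => 1) - nn w e (t 0) - nn w e (t 1) - nn w e (t 2)
      + ov w e (t 0) (t 1) + ov w e (t 0) (t 2) + ov w e (t 1) (t 2) := by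
    unfold nn ov
    simp only [← av_add, ← av_sub]
    refine av_mono hw fun u => ?_
    unfold unc
    rcases h.nb01 (t 0) u with a | a <;> rcases h.nb01 (t 1) u with b | b <;>
    rcases h.nb01 (t 2) u with c | c <;> rw [a, b, c] <;> norm_num
  have a0 := (abs_le.1 (T.hn 0)).1
  have a1 := (abs_le.1 (T.hn 1)).1
  have a2 := (abs_le.1 (T.hn 2)).1
  linarith [T.o01, T.o02, T.o12]

theorem far_le {w : V → ℝ} (h : OG e) (hw : ∀ v, 0 ≤ w v) {t : Fin 3 → V} {s : ℝ}
    (T : Tr w e t s) (k : Fin 3) : av w (far w e t k) ≤ 200 * s ^ 2 := by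
  have : av w (far w e t k) ≤ 200 * Dt w e (t k) := by
    unfold Dt
    rw [← av_mul]
    refine av_mono hw fun u => ?_
    unfold far
    have := h.nb0 (t k) u
    have := ds0 (e := e) hw u (t k)
    split_ifs with hh
    · rw [mul_zero]; positivity
    · push Not at hh; nlinarith
  linarith [T.hD k]

theorem ex_le {w : V → ℝ} (h : OG e) (hw : ∀ v, 0 ≤ w v) (h1 : av w (fun _ => 1) = 1) {t : Fin 3 → V} {s : ℝ}
    (T : Tr w e t s) : av w (ex w e t) ≤ 4 * s := by
  unfold ex
  rw [av_add, av_add, av_add]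
  have := unc_le h hw h1 T
  have := far_le h hw T 0
  have := far_le h hw T 1
  have := far_le h hw T 2
  have := T.hs; have := T.hs'
  have e1 : (av w fun v => unc e t v) = av w (unc e t) := rfl
  have e2 : ∀ k, (av w fun v => far w e t k v) = av w (far w e t k) := fun k => rfl
  rw [e1, e2, e2, e2]
  nlinarith

theorem ds_far {w : V → ℝ} (h : OG e) (hw : ∀ v, 0 ≤ w v) {t : Fin 3 → V} {s : ℝ}
    (T : Tr w e t s) (u : V) :
    ¬ (ds w e u (t 0) ≤ 1 / 200 ∧ ds w e u (t 1) ≤ 1 / 200) ∧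
    ¬ (ds w e u (t 0) ≤ 1 / 200 ∧ ds w e u (t 2) ≤ 1 / 200) ∧
    ¬ (ds w e u (t 1) ≤ 1 / 200 ∧ ds w e u (t 2) ≤ 1 / 200) := by
  have a0 := (abs_le.1 (T.hn 0)).1
  have a1 := (abs_le.1 (T.hn 1)).1
  have a2 := (abs_le.1 (T.hn 2)).1
  have := T.hs; have := T.hs'
  have hs2 : s ^ 2 ≤ s := by nlinarith
  refine ⟨?_, ?_, ?_⟩ <;> rintro ⟨p, q⟩
  · have := ds_tri (e := e) hw u (t 0) (t 1)
    rw [ds_eq h w (t 0) (t 1)] at this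
    linarith [T.o01]
  · have := ds_tri (e := e) hw u (t 0) (t 2)
    rw [ds_eq h w (t 0) (t 2)] at this
    linarith [T.o02]
  · have := ds_tri (e := e) hw u (t 1) (t 2)
    rw [ds_eq h w (t 1) (t 2)] at this
    linarith [T.o12]

theorem xi01 (w : V → ℝ) (e : V → V → ℝ) (t : Fin 3 → V) (u : V) : xi w e t u = 0 ∨ xi w e t u = 1 := by
  unfold xi; split_ifs <;> simp

theorem xi_one {w : V → ℝ} {t : Fin 3 → V} {u : V} (hx : xi w e t u = 1) (k : Fin 3) :
    1 / 200 < ds w e u (t k) := by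
  unfold xi at hx
  split_ifs at hx <;> simp_all
  fin_cases k <;> assumption

theorem xi_zero {w : V → ℝ} {t : Fin 3 → V} {u : V} (hx : xi w e t u = 0) :
    ds w e u (t (col w e t u)) ≤ 1 / 200 := by
  unfold xi at hx
  unfold col
  split_ifs at hx ⊢ <;> simp_all

theorem xi_ex {w : V → ℝ} (h : OG e) (t : Fin 3 → V) (u : V) : xi w e t u ≤ ex w e t u := by
  unfold xi ex far unc
  rcases h.nb01 (t 0) u with a | a <;> rcases h.nb01 (t 1) u with b | b <;>
    rcases h.nb01 (t 2) u with c | c <;> rw [a, b, c] <;> split_ifs <;> norm_num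

theorem ind_ex {w : V → ℝ} (h : OG e) (hw : ∀ v, 0 ≤ w v) {t : Fin 3 → V} {s : ℝ}
    (T : Tr w e t s) (u : V) (k : Fin 3) : |nb e (t k) u - ind (col w e t) k u| ≤ ex w e t u := by
  obtain ⟨d1, d2, d3⟩ := ds_far h hw T u
  unfold ind ex far unc col
  by_cases h0 : ds w e u (t 0) ≤ 1 / 200 <;> by_cases h1 : ds w e u (t 1) ≤ 1 / 200 <;>
    by_cases h2 : ds w e u (t 2) ≤ 1 / 200 <;> simp only [h0, h1, h2] at d1 d2 d3 ⊢ <;>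
    first | (exfalso; simp at d1; done) | (exfalso; simp at d2; done) | (exfalso; simp at d3; done) | skip
  all_goals
    rcases h.nb01 (t 0) u with a | a <;> rcases h.nb01 (t 1) u with b | b <;>
    rcases h.nb01 (t 2) u with c | c <;> fin_cases k <;> (simp [a, b, c] <;> norm_num)

end FDFlb


namespace FDFlb
open Finset

variable {V : Type} [Fintype V] {e : V → V → ℝ}

theorem num1 {a b c s : ℝ} (hs : 0 < s) (hs' : s ≤ 1 / 10 ^ 11) (hb : 0 ≤ b) (hc : 0 ≤ c)
    (hba : b ≤ a) (hca : c ≤ a) (ha : a ≤ 1 / 3 + s) (hd : 1 / 200 - 10 * s ≤ b + c + (1 / 3 - a)) :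
    1 / 1400 ≤ 1 / 9 + (a + b + c) ^ 2 - 2 * (a ^ 2 + b ^ 2 + c ^ 2) := by
  have h1 : (b - c) ^ 2 ≤ a * (b + c) := by
    nlinarith [mul_nonneg hb hc, mul_nonneg hb (sub_nonneg.2 hba), mul_nonneg hc (sub_nonneg.2 hca)]
  have h2 : 1 / 9 - a ^ 2 + a * (b + c) ≤ 1 / 9 + (a + b + c) ^ 2 - 2 * (a ^ 2 + b ^ 2 + c ^ 2) := by
    nlinarith
  refine le_trans ?_ h2
  have ha0 : 0 ≤ a := hb.trans hba
  by_cases h6 : a < 1 / 6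
  · nlinarith [mul_nonneg ha0 (add_nonneg hb hc)]
  · push Not at h6
    have hbc : 1 / 6 * (b + c) ≤ a * (b + c) := mul_le_mul_of_nonneg_right h6 (by linarith)
    have : 1 / 9 - a ^ 2 = (1 / 3 - a) * (1 / 3 + a) := by ring
    rw [this]
    by_cases hA : 0 ≤ 1 / 3 - a
    · have : (1 / 3 - a) * (1 / 6) ≤ (1 / 3 - a) * (1 / 3 + a) := mul_le_mul_of_nonneg_left (by linarith) hA
      linarith
    · push Not at hA
      have : -s ≤ (1 / 3 - a) * (1 / 3 + a) := by nlinarith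
      linarith

theorem num2 {n0 n1 n2 m0 m1 m2 n s : ℝ} (hs : 0 < s) (hs' : s ≤ 1 / 10 ^ 11) (h0 : 0 ≤ n0) (h1 : 0 ≤ n1) (h2 : 0 ≤ n2)
    (k0 : n0 ≤ m0) (k1 : n1 ≤ m1) (k2 : n2 ≤ m2) (l0 : m0 ≤ 1 / 3 + s) (l1 : m1 ≤ 1 / 3 + s) (l2 : m2 ≤ 1 / 3 + s)
    (hn : n ≤ n0 + n1 + n2 + 4 * s)
    (d0 : 1 / 200 < n + m0 - 2 * n0) (d1 : 1 / 200 < n + m1 - 2 * n1) (d2 : 1 / 200 < n + m2 - 2 * n2) :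
    1 / 1400 ≤ 1 / 9 + (n0 + n1 + n2) ^ 2 - 2 * (n0 ^ 2 + n1 ^ 2 + n2 ^ 2) := by
  rcases le_total n0 n1 with a | a
  · rcases le_total n1 n2 with b | b
    · have := num1 hs hs' h0 h1 (a.trans b) b (by linarith) (by linarith)
      linarith [this]
    · have := num1 hs hs' h0 h2 a b (by linarith) (by linarith)
      linarith [this]
  · rcases le_total n0 n2 with b | b
    · have := num1 hs hs' h0 h1 b (a.trans b) (by linarith) (by linarith)
      linarith [this]
    · have := num1 hs hs' h1 h2 a b (by linarith) (by linarith)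
      linarith [this]

theorem sq_aux {N n r : ℝ} (hN0 : 0 ≤ N) (hN2 : N ≤ 2) (hn0 : 0 ≤ n) (hr : 0 ≤ r) (h : N - r ≤ n) :
    N ^ 2 - 4 * r ≤ n ^ 2 := by
  by_cases hc : N ≤ n
  · nlinarith
  · push Not at hc
    have : (N - n) * (N + n) ≤ r * 4 := mul_le_mul (by linarith) (by linarith) (by linarith) hr
    linarith

theorem num3 {n0 n1 n2 m0 m1 m2 n s d dm R Q : ℝ} (hs : 0 < s) (hs' : s ≤ 1 / 10 ^ 11)
    (h0 : 0 ≤ n0) (h1 : 0 ≤ n1) (h2 : 0 ≤ n2)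
    (k0 : n0 ≤ m0) (k1 : n1 ≤ m1) (k2 : n2 ≤ m2) (l0 : |m0 - 1 / 3| ≤ s) (l1 : |m1 - 1 / 3| ≤ s) (l2 : |m2 - 1 / 3| ≤ s)
    (hn0 : 0 ≤ n)
    (hn : n ≤ n0 + n1 + n2 + 3 * s + 3 * s ^ 2) (hn' : n0 + n1 + n2 - 3 * s ^ 2 ≤ n)
    (d0 : 1 / 200 < n + m0 - 2 * n0) (d1 : 1 / 200 < n + m1 - 2 * n1) (d2 : 1 / 200 < n + m2 - 2 * n2)
    (hdm : d + dm + n = 1) (hR : dm / 3 - s ≤ R)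
    (hQ : n0 * (m0 - n0) + n1 * (m1 - n1) + n2 * (m2 - n2) - 6 * s ^ 2 ≤ Q) :
    4 / 9 + 1 / 1500 ≤ d ^ 2 + 2 * R + n ^ 2 + 2 * Q := by
  rw [abs_le] at l0 l1 l2
  have hs2 : s ^ 2 ≤ s / 10 ^ 11 := by nlinarith
  have key := num2 hs hs' h0 h1 h2 k0 k1 k2 (by linarith) (by linarith) (by linarith) (n := n)
    (by linarith) d0 d1 d2
  have q : ∀ a m : ℝ, 0 ≤ a → a ≤ 1 → -s ≤ m - 1 / 3 → a * (1 / 3 - a) - s ≤ a * (m - a) := by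
    intro a m ha ha1 hm
    have h5 : a * (-s) ≤ a * (m - 1 / 3) := mul_le_mul_of_nonneg_left hm ha
    have h6 : a * s ≤ 1 * s := mul_le_mul_of_nonneg_right ha1 hs.le
    linarith
  have q0 := q n0 m0 h0 (by linarith) l0.1
  have q1 := q n1 m1 h1 (by linarith) l1.1
  have q2 := q n2 m2 h2 (by linarith) l2.1
  have hnn := sq_aux (N := n0 + n1 + n2) (n := n) (r := 3 * s ^ 2) (by positivity) (by linarith) hn0 (by positivity) hn'
  have hd := sq_nonneg (d - 1 / 3)
  have hd' : d ^ 2 = (d - 1 / 3) ^ 2 + 2 / 3 * d - 1 / 9 := by ring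
  rw [hd']
  linarith

theorem Q_ptw {p A r a0 a1 a2 b0 b1 b2 : ℝ} (hp : p = 0 ∨ p = 1) (hA : A = 0 ∨ A = 1)
    (hr : r = 0 ∨ r = 1) (h0 : a0 = 0 ∨ a0 = 1) (h1 : a1 = 0 ∨ a1 = 1) (h2 : a2 = 0 ∨ a2 = 1)
    (k0 : b0 = 0 ∨ b0 = 1) (k1 : b1 = 0 ∨ b1 = 1) (k2 : b2 = 0 ∨ b2 = 1) :
    p * a0 * (b0 * A) + p * a1 * (b1 * A) + p * a2 * (b2 * A) - a0 * |r - b0| - a1 * |r - b1|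
      - a2 * |r - b2| - a0 * a1 - a0 * a2 - a1 * a2 ≤ p * (r * A) := by
  have hp0 : 0 ≤ p ∧ p ≤ 1 := by rcases hp with rfl | rfl <;> norm_num
  have hA0 : 0 ≤ A ∧ A ≤ 1 := by rcases hA with rfl | rfl <;> norm_num
  have hr0 : 0 ≤ r ∧ r ≤ 1 := by rcases hr with rfl | rfl <;> norm_num
  have key : ∀ a b : ℝ, (a = 0 ∨ a = 1) → (b = 0 ∨ b = 1) →
      p * a * (b * A) - a * |r - b| ≤ p * (r * A) * a := by
    intro a b ha hb
    rcases hp with rfl | rfl <;> rcases hA with rfl | rfl <;> rcases hr with rfl | rfl <;>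
      rcases ha with rfl | rfl <;> rcases hb with rfl | rfl <;> norm_num
  have f0 := key a0 b0 h0 k0
  have f1 := key a1 b1 h1 k1
  have f2 := key a2 b2 h2 k2
  have hM0 : p * (r * A) = 0 ∨ p * (r * A) = 1 := by
    rcases hp with rfl | rfl <;> rcases hA with rfl | rfl <;> rcases hr with rfl | rfl <;> norm_num
  have : p * (r * A) * a0 + p * (r * A) * a1 + p * (r * A) * a2 ≤ p * (r * A) + a0 * a1 + a0 * a2 + a1 * a2 := by
    rcases hM0 with hM | hM <;> rw [hM] <;>
    rcases h0 with rfl | rfl <;> rcases h1 with rfl | rfl <;> rcases h2 with rfl | rfl <;> norm_num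
  linarith

theorem lk_eq (w : V → ℝ) (e : V → V → ℝ) (v : V) : lk w e v = dd w e v ^ 2 +
    2 * (av w fun u => e u v * dd w e u) + nn w e v ^ 2 +
    2 * (av w fun u => av w fun x => nb e v u * (nb e u x * ad e v x)) := by
  have a1 : (av w fun u => av w fun x => e v u * e v x) = dd w e v ^ 2 := by
    simp only [av_mul, av_mul_right]; unfold dd; ring
  have a2 : (av w fun u => av w fun x => e u v * e u x) = av w fun u => e u v * dd w e u := by
    simp only [av_mul]; rfl
  have a3 : (av w fun u => av w fun x => e x v * e x u) = av w fun u => e u v * dd w e u := by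
    rw [av_comm]; exact a2
  have a4 : (av w fun u => av w fun x => nb e v u * nb e v x) = nn w e v ^ 2 := by
    simp only [av_mul, av_mul_right]; unfold nn; ring
  have a5 : (av w fun u => av w fun x => nb e v x * (nb e x u * ad e v u)) =
     av w fun u => av w fun x => nb e v u * (nb e u x * ad e v x) := by
    rw [av_comm]
  have : lk w e v = (av w fun u => av w fun x => e v u * e v x) + (av w fun u => av w fun x => e u v * e u x)
     + (av w fun u => av w fun x => e x v * e x u) + (av w fun u => av w fun x => nb e v u * nb e v x)
     + (av w fun u => av w fun x => nb e v u * (nb e u x * ad e v x))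
     + (av w fun u => av w fun x => nb e v x * (nb e x u * ad e v u)) := by
    unfold lk
    simp only [← av_add]
    refine av_congr fun u => av_congr fun x => ?_
    unfold hh
    rw [ad_eq, ad_eq, nb_symm e u v, nb_symm e x v, nb_symm e x u]; ring
  rw [this, a1, a2, a3, a4, a5]; ring

theorem lk_low (h : OG e) {w : V → ℝ} (hw : ∀ v, 0 ≤ w v) (h1 : av w (fun _ => 1) = 1) {t : Fin 3 → V} {s : ℝ}
    (T : Tr w e t s) (hd : av w (fun u => (dd w e u - 1 / 3) ^ 2) ≤ s ^ 2) {v : V}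
    (hv : ∀ k, 1 / 200 < ds w e v (t k)) : 4 / 9 + 1 / 1500 ≤ lk w e v := by
  have hc : ∀ c, (av w fun _ => c) = c := fun c => by rw [av_const, h1, mul_one]
  have hs := T.hs
  rw [lk_eq]
  have hovnn : ∀ k, ov w e v (t k) ≤ nn w e (t k) := by
    intro k
    refine av_mono hw fun u => ?_
    exact mul_le_of_le_one_left (h.nb0 _ _) (h.nb1 _ _)
  have hdk : ∀ k, 1 / 200 < nn w e v + nn w e (t k) - 2 * ov w e v (t k) := by
    intro k; rw [← ds_eq h]; exact hv k
  refine num3 (n0 := ov w e v (t 0)) (n1 := ov w e v (t 1)) (n2 := ov w e v (t 2))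
    (m0 := nn w e (t 0)) (m1 := nn w e (t 1)) (m2 := nn w e (t 2)) (n := nn w e v)
    (dm := av w fun u => e u v) T.hs T.hs'
    (ov0 h hw _ _) (ov0 h hw _ _) (ov0 h hw _ _) (hovnn 0) (hovnn 1) (hovnn 2) (T.hn 0) (T.hn 1) (T.hn 2)
    (av_nonneg hw fun _ => h.nb0 _ _) ?_ ?_ (hdk 0) (hdk 1) (hdk 2) ?_ ?_ ?_
  · have := unc_le h hw h1 T
    have : nn w e v ≤ ov w e v (t 0) + ov w e v (t 1) + ov w e v (t 2) + av w (unc e t) := by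
      unfold nn ov
      simp only [← av_add]
      refine av_mono hw fun u => ?_
      unfold unc
      rcases h.nb01 v u with d | d <;>
      rcases h.nb01 (t 0) u with a | a <;> rcases h.nb01 (t 1) u with b | b <;>
      rcases h.nb01 (t 2) u with c | c <;> rw [a, b, c, d] <;> norm_num
    linarith
  · have : ov w e v (t 0) + ov w e v (t 1) + ov w e v (t 2) - ov w e (t 0) (t 1) - ov w e (t 0) (t 2)
      - ov w e (t 1) (t 2) ≤ nn w e v := by
      unfold nn ov
      simp only [← av_add, ← av_sub]
      refine av_mono hw fun u => ?_
      rcases h.nb01 v u with d | d <;>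
      rcases h.nb01 (t 0) u with a | a <;> rcases h.nb01 (t 1) u with b | b <;>
      rcases h.nb01 (t 2) u with c | c <;> rw [a, b, c, d] <;> norm_num
    linarith [T.o01, T.o02, T.o12]
  · unfold dd nn
    rw [← av_add, ← av_add, ← h1]
    refine av_congr fun u => ?_
    unfold nb; ring
  · have : (av w fun u => e u v) / 3 - (av w (fun u => (dd w e u - 1 / 3) ^ 2) / (2 * s) + s / 2) ≤
        av w fun u => e u v * dd w e u := by
      conv_lhs => rw [← hc (s / 2)]
      rw [← av_div, ← av_div, ← av_add, ← av_sub]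
      refine av_mono hw fun u => ?_
      generalize dd w e u = x
      have e0 := h.e0 u v
      have hsq : 0 ≤ (x - 1 / 3 + s * e u v) ^ 2 / (2 * s) := by positivity
      have hee : e u v * e u v ≤ 1 := by rcases h.zo u v with a | a <;> rw [a] <;> norm_num
      have hx : (x - 1 / 3 + s * e u v) ^ 2 / (2 * s) = (x - 1 / 3) ^ 2 / (2 * s) + (x - 1 / 3) * e u v
          + s / 2 * (e u v * e u v) := by
        field_simp
        ring
      rw [hx] at hsq
      nlinarith
    have h3 : av w (fun u => (dd w e u - 1 / 3) ^ 2) / (2 * s) ≤ s / 2 := by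
      rw [div_le_iff₀ (by positivity)]; nlinarith
    linarith
  · have hk : ∀ k, (av w fun u => av w fun x => nb e v u * nb e (t k) u * (nb e (t k) x * ad e v x)) =
        ov w e v (t k) * (nn w e (t k) - ov w e v (t k)) := by
      intro k
      simp only [av_mul, av_mul_right]
      unfold nn ov
      rw [← av_sub]
      congr 1
      refine av_congr fun x => ?_
      rw [ad_eq]; ring
    have hD : ∀ k, (av w fun u => av w fun x => nb e (t k) u * |nb e u x - nb e (t k) x|) = Dt w e (t k) := by
      intro k
      simp only [av_mul]; rfl
    have ho : ∀ k l, (av w fun u => av w fun _ => nb e (t k) u * nb e (t l) u) = ov w e (t k) (t l) := by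
      intro k l
      simp only [hc]; rfl
    have key : (av w fun u => av w fun x => (nb e v u * nb e (t 0) u * (nb e (t 0) x * ad e v x)
      + nb e v u * nb e (t 1) u * (nb e (t 1) x * ad e v x) + nb e v u * nb e (t 2) u * (nb e (t 2) x * ad e v x)
      - nb e (t 0) u * |nb e u x - nb e (t 0) x| - nb e (t 1) u * |nb e u x - nb e (t 1) x|
      - nb e (t 2) u * |nb e u x - nb e (t 2) x|
      - nb e (t 0) u * nb e (t 1) u - nb e (t 0) u * nb e (t 2) u - nb e (t 1) u * nb e (t 2) u))
      ≤ av w fun u => av w fun x => nb e v u * (nb e u x * ad e v x) := by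
      refine av_mono hw fun u => av_mono hw fun x => ?_
      exact Q_ptw (h.nb01 _ _) (h.ad01 _ _) (h.nb01 _ _) (h.nb01 _ _) (h.nb01 _ _) (h.nb01 _ _)
        (h.nb01 _ _) (h.nb01 _ _) (h.nb01 _ _)
    have key2 : (av w fun u => av w fun x => (nb e v u * nb e (t 0) u * (nb e (t 0) x * ad e v x)
      + nb e v u * nb e (t 1) u * (nb e (t 1) x * ad e v x) + nb e v u * nb e (t 2) u * (nb e (t 2) x * ad e v x)
      - nb e (t 0) u * |nb e u x - nb e (t 0) x| - nb e (t 1) u * |nb e u x - nb e (t 1) x|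
      - nb e (t 2) u * |nb e u x - nb e (t 2) x|
      - nb e (t 0) u * nb e (t 1) u - nb e (t 0) u * nb e (t 2) u - nb e (t 1) u * nb e (t 2) u)) =
      (av w fun u => av w fun x => nb e v u * nb e (t 0) u * (nb e (t 0) x * ad e v x))
      + (av w fun u => av w fun x => nb e v u * nb e (t 1) u * (nb e (t 1) x * ad e v x))
      + (av w fun u => av w fun x => nb e v u * nb e (t 2) u * (nb e (t 2) x * ad e v x))
      - (av w fun u => av w fun x => nb e (t 0) u * |nb e u x - nb e (t 0) x|)
      - (av w fun u => av w fun x => nb e (t 1) u * |nb e u x - nb e (t 1) x|)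
      - (av w fun u => av w fun x => nb e (t 2) u * |nb e u x - nb e (t 2) x|)
      - (av w fun u => av w fun _ => nb e (t 0) u * nb e (t 1) u)
      - (av w fun u => av w fun _ => nb e (t 0) u * nb e (t 2) u)
      - (av w fun u => av w fun _ => nb e (t 1) u * nb e (t 2) u) := by
      simp only [← av_add, ← av_sub]
    rw [key2, hk, hk, hk, hD, hD, hD, ho, ho, ho] at key
    linarith [T.o01, T.o02, T.o12, T.hD 0, T.hD 1, T.hD 2]

end FDFlb


namespace FDFlb
open Finset

variable {V : Type} [Fintype V] {e : V → V → ℝ}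

theorem fin_num {P Q τ L g : ℝ} (hτ : 0 ≤ τ) (hτ' : τ ≤ 1 / 10 ^ 10) (hg : 0 ≤ g) (hg' : g ≤ 4 / 9)
    (hQ : (1 - τ) ^ 3 * g ≤ Q) (hL : (4 / 9 + 1 / 1500) * τ ≤ L) (hP : Q + 3 * L - 3 * τ ^ 2 ≤ P) : g ≤ P := by
  have h1 : 1 - 3 * τ ≤ (1 - τ) ^ 3 := by nlinarith [pow_nonneg hτ 3, sq_nonneg τ]
  have h2 : (1 - 3 * τ) * g ≤ (1 - τ) ^ 3 * g := mul_le_mul_of_nonneg_right h1 hg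
  have h3 : τ * g ≤ τ * (4 / 9) := mul_le_mul_of_nonneg_left hg' hτ
  have h4 : τ ^ 2 ≤ 1 / 10 ^ 10 * τ := by nlinarith
  linarith

theorem delete (h : OG e) {w : V → ℝ} (hw : ∀ v, 0 ≤ w v) (h1 : av w (fun _ => 1) = 1) {t : Fin 3 → V} {s : ℝ}
    (T : Tr w e t s) (hd : av w (fun u => (dd w e u - 1 / 3) ^ 2) ≤ s ^ 2) {ε : ℝ} (hε : 0 < ε) (hε' : ε ≤ 4 / 9)
    (hC4 : av w (HH e w w) ≤ ε ^ 2 / (2 * 10 ^ 12)) : 4 / 9 - ε ≤ PP w e := by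
  have hs := T.hs
  have hs' := T.hs'
  set ξ := xi w e t with hξ
  set c := col w e t with hcdef
  have hξ01 : ∀ v, ξ v = 0 ∨ ξ v = 1 := xi01 w e t
  have hξ0 : ∀ v, 0 ≤ ξ v := fun v => by rcases hξ01 v with a | a <;> rw [a]; norm_num
  have hξ1 : ∀ v, ξ v ≤ 1 := fun v => by rcases hξ01 v with a | a <;> rw [a]; norm_num
  have hex := ex_le h hw h1 T
  obtain ⟨τ, hτ⟩ : ∃ τ, τ = av w ξ := ⟨_, rfl⟩
  have hτ0 : 0 ≤ τ := by rw [hτ]; exact av_nonneg hw hξ0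
  have hτ4 : τ ≤ 4 * s := by rw [hτ]; exact (av_mono hw (xi_ex h t)).trans hex
  have hdel := PP_del h hw h1 hξ01
  have hL : (4 / 9 + 1 / 1500) * τ ≤ av w (fun v => ξ v * lk w e v) := by
    rw [hτ, ← av_mul]
    refine av_mono hw fun v => ?_
    rcases hξ01 v with a | a
    · rw [a]; norm_num
    · rw [a]
      have := lk_low h hw h1 T hd (v := v) (xi_one a)
      linarith
  rw [← hτ] at hdel
  refine fin_num (τ := τ) hτ0 (by linarith) (by linarith) (by linarith) ?_ hL hdel
  obtain ⟨ρ, hρ⟩ : ∃ ρ, ρ = 1 / (1 - τ) := ⟨_, rfl⟩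
  have hτ1 : 0 < 1 - τ := by linarith
  have hρ0 : 0 < ρ := by rw [hρ]; positivity
  have hρ1 : ρ * (1 - τ) = 1 := by rw [hρ]; field_simp
  have hρ2 : ρ ≤ 1 + 1 / 10 ^ 5 := by
    rw [hρ, div_le_iff₀ hτ1]; nlinarith
  set w1 : V → ℝ := fun v => w v * (1 - ξ v) with hw1
  have hw10 : ∀ v, 0 ≤ w1 v := fun v => mul_nonneg (hw v) (by linarith [hξ1 v])
  have hw11 : ∀ v, w1 v ≤ w v := fun v => mul_le_of_le_one_right (hw v) (by linarith [hξ0 v])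
  set w' : V → ℝ := fun v => w1 v * ρ with hw'
  have hw'0 : ∀ v, 0 ≤ w' v := fun v => mul_nonneg (hw10 v) hρ0.le
  have hav : ∀ f : V → ℝ, av w' f = ρ * av w (fun v => (1 - ξ v) * f v) := by
    intro f
    rw [hw', av_w_mul w1 (fun _ => ρ), av_mul, hw1, av_w_mul]
  have main : 4 / 9 - ε ≤ PP w' e := by
    refine tripart h hw'0 ?_ c ?_ ?_ hε ?_
    · rw [hav]
      simp only [mul_one]
      rw [av_sub, h1, show (av w fun v => ξ v) = τ from hτ.symm, hρ1]
    · intro k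
      rw [hav]
      obtain ⟨A, hA⟩ : ∃ A, A = av w (fun v => (1 - ξ v) * ind c k v) := ⟨_, rfl⟩
      rw [← hA]
      have hp : ∀ v, |(1 - ξ v) * ind c k v - nb e (t k) v| ≤ 2 * ex w e t v := by
        intro v
        have a1 := ind_ex h hw T v k
        have a2 : ξ v ≤ _ := xi_ex h t v
        have a3 := ind0 c k v
        have a4 := ind1 c k v
        have a5 : ξ v * ind c k v ≤ ξ v := mul_le_of_le_one_right (hξ0 v) a4
        have a6 : 0 ≤ ξ v * ind c k v := mul_nonneg (hξ0 v) a3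
        rw [abs_le] at a1 ⊢
        constructor <;> nlinarith [a1.1, a1.2]
      have u1 : A ≤ nn w e (t k) + 2 * av w (ex w e t) := by
        rw [hA]; unfold nn; rw [← av_mul, ← av_add]
        exact av_mono hw fun v => by linarith [(abs_le.1 (hp v)).2]
      have u2 : nn w e (t k) - 2 * av w (ex w e t) ≤ A := by
        rw [hA]; unfold nn; rw [← av_mul, ← av_sub]
        exact av_mono hw fun v => by linarith [(abs_le.1 (hp v)).1]
      have u3 := abs_le.1 (T.hn k)
      have : ρ * A = A / (1 - τ) := by rw [hρ]; ring
      rw [this, abs_le]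
      constructor
      · rw [le_sub_iff_add_le, le_div_iff₀ hτ1]; nlinarith [u3.1, u3.2]
      · rw [sub_le_iff_le_add, div_le_iff₀ hτ1]; nlinarith [u3.1, u3.2]
    · intro v hv
      have hξv : ξ v = 0 := by
        rcases hξ01 v with a | a
        · exact a
        · exfalso; apply hv; simp [hw', hw1, a]
      have hdv : ds w e v (t (c v)) ≤ 1 / 200 := xi_zero hξv
      have : ib w' e c v + ob w' e c v ≤ ρ * (ds w e v (t (c v)) + av w (ex w e t)) := by
        unfold ib ob
        rw [← av_add, hav]
        refine mul_le_mul_of_nonneg_left ?_ hρ0.le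
        unfold ds
        rw [← av_add]
        refine av_mono hw fun u => ?_
        have a1 := ind_ex h hw T u (c v)
        have a2 : sm c v u = ind c (c v) u := by unfold sm ind; simp only [eq_comm]
        have a3 : sm c v u * ad e v u + (1 - sm c v u) * nb e v u = |nb e v u - ind c (c v) u| := by
          rw [a2, ad_eq]; unfold ind
          rcases h.nb01 v u with b | b <;> rw [b] <;> split_ifs <;> norm_num
        rw [a3]
        have a4 := abs_sub_le (nb e v u) (nb e (t (c v)) u) (ind c (c v) u)
        have a5 : (1 - ξ u) * |nb e v u - ind c (c v) u| ≤ |nb e v u - ind c (c v) u| :=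
          mul_le_of_le_one_left (abs_nonneg _) (by linarith [hξ0 u])
        linarith
      refine this.trans ?_
      calc ρ * (ds w e v (t (c v)) + av w (ex w e t)) ≤ ρ * (1 / 200 + 1 / 1000) :=
            mul_le_mul_of_nonneg_left (by linarith) hρ0.le
        _ ≤ (1 + 1 / 10 ^ 5) * (1 / 200 + 1 / 1000) := mul_le_mul_of_nonneg_right hρ2 (by norm_num)
        _ ≤ 1 / 100 := by norm_num
    · rw [hw', HH_scale]
      have b1 : av w1 (HH e w1 w1) ≤ av w (HH e w w) := by
        refine (av_mono hw10 fun v => HH_mono h hw10 hw10 hw11 hw11 v).trans ?_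
        exact av_mono_w hw11 (h.HH0 hw hw)
      have b0 : 0 ≤ av w1 (HH e w1 w1) := av_nonneg hw10 (h.HH0 hw10 hw10)
      have b2 : ρ ^ 4 ≤ 2 := (pow_le_pow_left₀ hρ0.le hρ2 4).trans (by norm_num)
      calc _ ≤ 2 * (ε ^ 2 / (2 * 10 ^ 12)) := mul_le_mul b2 (b1.trans hC4) b0 (by norm_num)
        _ = _ := by ring
  rw [hw', PP_scale] at main
  have : (1 - τ) ^ 3 * (ρ ^ 3 * PP w1 e) = PP w1 e := by
    have : (1 - τ) ^ 3 * (ρ ^ 3 * PP w1 e) = (ρ * (1 - τ)) ^ 3 * PP w1 e := by ring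
    rw [this, hρ1]; ring
  rw [← this]
  exact mul_le_mul_of_nonneg_left main (by positivity)

theorem KK0 (h : OG e) {w : V → ℝ} (hw : ∀ v, 0 ≤ w v) : 0 ≤ KK w e :=
  av_nonneg hw fun _ => av_nonneg hw fun _ => av_nonneg hw fun _ =>
    mul_nonneg (mul_nonneg (h.nb0 _ _) (h.nb0 _ _)) (h.ad0 _ _)

set_option maxHeartbeats 1000000 in
theorem wmain (h : OG e) {w : V → ℝ} (hw : ∀ v, 0 ≤ w v) (h1 : av w (fun _ => 1) = 1)
    (hν : av w (nn w e) ≤ 1 / 3 + 1 / 10 ^ 24) {ε : ℝ} (hε : 0 < ε)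
    (hC4 : av w (HH e w w) ≤ ε ^ 2 / (2 * 10 ^ 12)) : 4 / 9 - ε ≤ PP w e := by
  by_contra hcon
  push Not at hcon
  have hK := KK0 h hw
  have hdd := av_cs hw h1 (dd w e)
  have hnn := av_cs hw h1 (nn w e)
  have hm := av_dd (e := e) h1
  have hν0 : 0 ≤ av w (nn w e) := av_nonneg hw fun _ => av_nonneg hw fun _ => h.nb0 _ _
  have hsqd := av_sq hw h1 (dd w e) (1 / 3)
  have hsqn := av_sq hw h1 (nn w e) (1 / 3)
  have hP : PP w e = 3 * av w (fun v => dd w e v ^ 2) + av w (fun v => nn w e v ^ 2) + 2 * KK w e := rfl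
  have hnn' : av w (fun v => nn w e v * nn w e v) = av w (fun v => nn w e v ^ 2) :=
    av_congr fun v => by ring
  by_cases hε' : ε ≤ 4 / 9
  swap
  · push Not at hε'
    nlinarith [sq_nonneg (av w (dd w e)), sq_nonneg (av w (nn w e))]
  by_cases hc : av w (nn w e) ≤ 1 / 3
  · rw [hm] at hdd
    nlinarith [mul_nonneg (sub_nonneg.2 hc) (by linarith : 0 ≤ 11 / 12 - 7 / 4 * av w (nn w e))]
  push Not at hc
  obtain ⟨η, hη⟩ : ∃ η, η = av w (nn w e) - 1 / 3 := ⟨_, rfl⟩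
  have hνη : av w (nn w e) = 1 / 3 + η := by linarith
  have hη0 : 0 < η := by linarith
  have hη1 : η ≤ 1 / 10 ^ 24 := by linarith
  rw [hνη] at hm hnn hsqn
  have hm' : av w (dd w e) = 1 / 3 - η / 2 := by rw [hm]; ring
  rw [hm'] at hdd hsqd
  have hη2 : η ^ 2 ≤ 1 / 10 ^ 24 * η := by nlinarith
  have hη20 := sq_nonneg η
  rw [show (1 / 3 - η / 2) ^ 2 = 1 / 9 - η / 3 + η ^ 2 / 4 by ring] at hdd
  rw [show (1 / 3 + η) ^ 2 = 1 / 9 + 2 / 3 * η + η ^ 2 by ring] at hnn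
  obtain ⟨q, hq⟩ : ∃ q, q = η ^ 2 := ⟨_, rfl⟩
  rw [← hq] at hdd hnn hη20 hη2
  obtain ⟨x, y, z, hxy, hxz, hyz, hB⟩ := exists_tri h hw h1 (η := 1 / 10 ^ 22 / 23) (by norm_num)
    (by linarith) (by rw [hsqn]; linarith) (by rw [hnn', hνη]; linarith)
  have hB' : 23 * (1 / 10 ^ 22 / 23 : ℝ) = (1 / 10 ^ 11) ^ 2 := by norm_num
  rw [hB'] at hB
  have := Dt0 h hw x; have := Dt0 h hw y; have := Dt0 h hw z
  have := ov0 h hw x y; have := ov0 h hw x z; have := ov0 h hw y z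
  have sx := sq_nonneg (nn w e x - 1 / 3)
  have sy := sq_nonneg (nn w e y - 1 / 3)
  have sz := sq_nonneg (nn w e z - 1 / 3)
  have T : Tr w e ![x, y, z] (1 / 10 ^ 11) := by
    refine ⟨by norm_num, le_refl _, ?_, ?_, ?_, ?_, ?_⟩
    · intro k
      fin_cases k
      · exact abs_le_of_sq_le_sq (by show (nn w e x - 1 / 3) ^ 2 ≤ _; linarith) (by norm_num)
      · exact abs_le_of_sq_le_sq (by show (nn w e y - 1 / 3) ^ 2 ≤ _; linarith) (by norm_num)
      · exact abs_le_of_sq_le_sq (by show (nn w e z - 1 / 3) ^ 2 ≤ _; linarith) (by norm_num)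
    · intro k
      fin_cases k
      · show Dt w e x ≤ _; linarith
      · show Dt w e y ≤ _; linarith
      · show Dt w e z ≤ _; linarith
    · show ov w e x y ≤ _; linarith
    · show ov w e x z ≤ _; linarith
    · show ov w e y z ≤ _; linarith
  have hd : av w (fun u => (dd w e u - 1 / 3) ^ 2) ≤ (1 / 10 ^ 11) ^ 2 := by
    rw [hsqd]; linarith
  have := delete h hw h1 T hd hε hε' hC4
  linarith

end FDFlb


namespace FDFlb
open Finset

theorem av_unif {V : Type} [Fintype V] (r : ℝ) (f : V → ℝ) : av (fun _ => r) f = r * ∑ v, f v := by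
  unfold av; rw [Finset.mul_sum]

open Classical in
noncomputable def ee {V : Type} (E : V → V → Prop) (u v : V) : ℝ := if E u v then 1 else 0

theorem ee_OG {V : Type} {E : V → V → Prop} (h : IsOrgraph E) : OG (ee E) := by
  refine ⟨fun u v => ?_, fun u v => ?_⟩
  · unfold ee; split_ifs <;> simp
  · by_cases a : E u v
    · right; unfold ee; rw [if_neg (h.2 _ _ a)]
    · left; unfold ee; rw [if_neg a]

theorem triple_fiber {V : Type} [Fintype V] [DecidableEq V] {s : Finset V} (hs : s.card = 3)
    (A : Finset (V × V × V)) (hA : ∀ p ∈ A, p.1 ≠ p.2.1 ∧ p.1 ≠ p.2.2 ∧ p.2.1 ≠ p.2.2) :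
    (A.filter fun p => ({p.1, p.2.1, p.2.2} : Finset V) = s).card ≤ 6 := by
  obtain ⟨x, y, z, hxy, hxz, hyz, rfl⟩ := Finset.card_eq_three.1 hs
  refine (Finset.card_le_card (t := {(x, y, z), (x, z, y), (y, x, z), (y, z, x), (z, x, y), (z, y, x)}) ?_).trans
    Finset.card_le_six
  rintro ⟨a, b, c⟩ hp
  rw [Finset.mem_filter] at hp
  obtain ⟨h1, h2⟩ := hp
  have h3 := hA _ h1
  simp only at h3 h2
  have ha : a ∈ ({x, y, z} : Finset V) := by rw [← h2]; simp
  have hb : b ∈ ({x, y, z} : Finset V) := by rw [← h2]; simp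
  have hc : c ∈ ({x, y, z} : Finset V) := by rw [← h2]; simp
  simp only [Finset.mem_insert, Finset.mem_singleton] at ha hb hc
  obtain ⟨d1, d2, d3⟩ := h3
  simp only [Finset.mem_insert, Finset.mem_singleton, Prod.mk.injEq]
  rcases ha with rfl | rfl | rfl <;> rcases hb with rfl | rfl | rfl <;> rcases hc with rfl | rfl | rfl <;>
    simp_all

open Classical in
theorem fdf_card {V : Type} [Fintype V] (E : V → V → Prop) :
    (univ.filter fun p : V × V × V => (p.1 ≠ p.2.1 ∧ p.1 ≠ p.2.2 ∧ p.2.1 ≠ p.2.2) ∧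
      FDFedge E p.1 p.2.1 p.2.2).card ≤ 6 * fdfCount V E := by
  unfold fdfCount
  refine Finset.card_le_mul_card_image_of_maps_to (f := fun p => {p.1, p.2.1, p.2.2}) ?_ 6 ?_
  · rintro ⟨a, b, c⟩ hp
    simp only [Finset.mem_filter, Finset.mem_univ, true_and] at hp
    obtain ⟨⟨d1, d2, d3⟩, hE⟩ := hp
    refine Finset.mem_filter.2 ⟨Finset.mem_powersetCard.2 ⟨Finset.subset_univ _, ?_⟩, a, b, c, d1, d2, d3, rfl, hE⟩
    exact Finset.card_eq_three.2 ⟨a, b, c, d1, d2, d3, rfl⟩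
  · intro s hs
    refine triple_fiber (Finset.mem_powersetCard.1 (Finset.mem_filter.1 hs).1).2 _ ?_
    intro p hp
    exact (Finset.mem_filter.1 hp).2.1

open Classical in
theorem hh_pt {V : Type} [Fintype V] {E : V → V → Prop} (h : IsOrgraph E) (u v x : V) :
    hh (ee E) u v x ≤ (if (u ≠ v ∧ u ≠ x ∧ v ≠ x) ∧ FDFedge E u v x then 1 else 0) +
      ((if u = v then 1 else 0) + (if u = x then 1 else 0) + (if v = x then 1 else 0)) := by
  have i0 : ∀ (p : Prop) [Decidable p], (0 : ℝ) ≤ if p then 1 else 0 := by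
    intro p _; split_ifs <;> norm_num
  have hle : hh (ee E) u v x ≤ 1 := by rcases hh01 (ee_OG h) u v x with a | a <;> rw [a]; norm_num
  have z1 := i0 (u = v); have z2 := i0 (u = x); have z3 := i0 (v = x)
  have z4 := i0 ((u ≠ v ∧ u ≠ x ∧ v ≠ x) ∧ FDFedge E u v x)
  by_cases a : u = v
  · rw [if_pos a] at z1 ⊢; linarith
  by_cases b : u = x
  · rw [if_pos b] at z2 ⊢; linarith
  by_cases c : v = x
  · rw [if_pos c] at z3 ⊢; linarith
  by_cases d : FDFedge E u v x
  · rw [if_pos ⟨⟨a, b, c⟩, d⟩] at z4 ⊢; linarith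
  · have : hh (ee E) u v x = 0 := by
      unfold FDFedge at d
      have k1 := h.2 u v; have k2 := h.2 u x; have k3 := h.2 v x
      unfold hh nb ee
      by_cases e1 : E u v <;> by_cases e2 : E v u <;> by_cases e3 : E u x <;> by_cases e4 : E x u <;>
        by_cases e5 : E v x <;> by_cases e6 : E x v <;> simp [e1, e2, e3, e4, e5, e6] at d k1 k2 k3 ⊢
    rw [this]; linarith

theorem PP_le {V : Type} [Fintype V] {E : V → V → Prop} (h : IsOrgraph E) (r : ℝ) (hr : 0 ≤ r) :
    PP (fun _ => r) (ee E) ≤ r ^ 3 * (6 * fdfCount V E + 3 * (Fintype.card V : ℝ) ^ 2) := by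
  classical
  rw [PP_eq]
  simp only [av_unif, ← Finset.mul_sum]
  have h1 : ∑ u : V, ∑ v : V, ∑ x : V, hh (ee E) u v x ≤
      6 * fdfCount V E + 3 * (Fintype.card V : ℝ) ^ 2 := by
    calc _ ≤ ∑ u : V, ∑ v : V, ∑ x : V, ((if (u ≠ v ∧ u ≠ x ∧ v ≠ x) ∧ FDFedge E u v x then (1 : ℝ) else 0) +
      ((if u = v then 1 else 0) + (if u = x then 1 else 0) + (if v = x then 1 else 0))) :=
          Finset.sum_le_sum fun u _ => Finset.sum_le_sum fun v _ => Finset.sum_le_sum fun x _ => hh_pt h u v x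
      _ = ((univ.filter fun p : V × V × V => (p.1 ≠ p.2.1 ∧ p.1 ≠ p.2.2 ∧ p.2.1 ≠ p.2.2) ∧
      FDFedge E p.1 p.2.1 p.2.2).card : ℝ) + 3 * (Fintype.card V : ℝ) ^ 2 := by
          rw [Finset.card_filter]
          push_cast
          rw [Fintype.sum_prod_type]
          simp only [Fintype.sum_prod_type, Finset.sum_add_distrib]
          congr 1
          simp
          ring
      _ ≤ _ := by
          have := fdf_card E
          have : ((univ.filter fun p : V × V × V => (p.1 ≠ p.2.1 ∧ p.1 ≠ p.2.2 ∧ p.2.1 ≠ p.2.2) ∧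
            FDFedge E p.1 p.2.1 p.2.2).card : ℝ) ≤ 6 * fdfCount V E := by exact_mod_cast this
          linarith
  calc _ = r ^ 3 * ∑ u : V, ∑ v : V, ∑ x : V, hh (ee E) u v x := by ring
    _ ≤ _ := mul_le_mul_of_nonneg_left h1 (by positivity)

open Classical in
theorem c4_card {V : Type} [Fintype V] {E : V → V → Prop} (h : IsOrgraph E) :
    (univ.filter fun p : V × V × V × V => c4k (ee E) p.1 p.2.1 p.2.2.1 p.2.2.2 ≠ 0).card ≤ 256 * c4Count V E := by
  unfold c4Count
  refine Finset.card_le_mul_card_image_of_maps_to (f := fun p => {p.1, p.2.1, p.2.2.1, p.2.2.2}) ?_ 256 ?_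
  · rintro ⟨a, b, c, d⟩ hp
    simp only [Finset.mem_filter, Finset.mem_univ, true_and] at hp
    unfold c4k at hp
    simp only [ne_eq, mul_eq_zero, not_or] at hp
    obtain ⟨⟨⟨⟨⟨h1, h2⟩, h3⟩, h4⟩, h5⟩, h6⟩ := hp
    have E1 : E a b := by by_contra k; exact h1 (by simp [ee, k])
    have E2 : E b c := by by_contra k; exact h2 (by simp [ee, k])
    have E3 : E c d := by by_contra k; exact h3 (by simp [ee, k])
    have E4 : E d a := by by_contra k; exact h4 (by simp [ee, k])
    have N1 : ¬ E a c := fun k => h5 (by simp [nb, ee, k, h.2 _ _ k])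
    have N2 : ¬ E c a := fun k => h5 (by simp [nb, ee, k, h.2 _ _ k])
    have N3 : ¬ E b d := fun k => h6 (by simp [nb, ee, k, h.2 _ _ k])
    have N4 : ¬ E d b := fun k => h6 (by simp [nb, ee, k, h.2 _ _ k])
    have d1 : a ≠ b := by rintro rfl; exact h.1 _ E1
    have d2 : a ≠ c := by rintro rfl; exact h.2 _ _ E1 E2
    have d3 : a ≠ d := by rintro rfl; exact h.1 _ E4
    have d4 : b ≠ c := by rintro rfl; exact h.1 _ E2
    have d5 : b ≠ d := by rintro rfl; exact h.2 _ _ E2 E3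
    have d6 : c ≠ d := by rintro rfl; exact h.1 _ E3
    refine Finset.mem_filter.2 ⟨Finset.mem_powersetCard.2 ⟨Finset.subset_univ _, ?_⟩, a, b, c, d, d1, d2, d3, d4, d5,
      d6, rfl, E1, E2, E3, E4, h.2 _ _ E1, h.2 _ _ E2, h.2 _ _ E3, h.2 _ _ E4, N1, N2, N3, N4⟩
    rw [Finset.card_insert_of_notMem, Finset.card_insert_of_notMem, Finset.card_pair d6] <;> simp [*]
  · intro s hs
    have hc := (Finset.mem_powersetCard.1 (Finset.mem_filter.1 hs).1).2
    refine (Finset.card_le_card (t := s ×ˢ s ×ˢ s ×ˢ s) ?_).trans ?_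
    · rintro ⟨a, b, c, d⟩ hp
      have := (Finset.mem_filter.1 hp).2
      simp only at this
      rw [← this]
      simp
    · simp [Finset.card_product, hc]

theorem C4_le {V : Type} [Fintype V] {E : V → V → Prop} (h : IsOrgraph E) (r : ℝ) (hr : 0 ≤ r) :
    av (fun _ => r) (HH (ee E) (fun _ => r) (fun _ => r)) ≤ r ^ 4 * (256 * c4Count V E) := by
  classical
  unfold HH
  simp only [av_unif, ← Finset.mul_sum]
  have h1 : ∑ u : V, ∑ v : V, ∑ x : V, ∑ y : V, c4k (ee E) u v x y ≤ 256 * c4Count V E := by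
    calc _ ≤ ∑ u : V, ∑ v : V, ∑ x : V, ∑ y : V, (if c4k (ee E) u v x y ≠ 0 then (1 : ℝ) else 0) := by
          refine Finset.sum_le_sum fun u _ => Finset.sum_le_sum fun v _ => Finset.sum_le_sum fun x _ =>
            Finset.sum_le_sum fun y _ => ?_
          have H := ee_OG h
          have : c4k (ee E) u v x y = 0 ∨ c4k (ee E) u v x y = 1 := by
            unfold c4k
            rcases H.zo u v with a | a <;> rcases H.zo v x with b | b <;> rcases H.zo x y with c | c <;>
              rcases H.zo y u with d | d <;> rcases H.nb01 u x with f | f <;> rcases H.nb01 v y with g | g <;>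
              simp [a, b, c, d, f, g]
          rcases this with a | a <;> simp [a]
      _ = ((univ.filter fun p : V × V × V × V => c4k (ee E) p.1 p.2.1 p.2.2.1 p.2.2.2 ≠ 0).card : ℝ) := by
          rw [Finset.card_filter]
          push_cast
          simp only [Fintype.sum_prod_type]
      _ ≤ _ := by exact_mod_cast c4_card h
  calc _ = r ^ 4 * ∑ u : V, ∑ v : V, ∑ x : V, ∑ y : V, c4k (ee E) u v x y := by ring
    _ ≤ _ := mul_le_mul_of_nonneg_left h1 (by positivity)

open Classical in
theorem und_card {V : Type} [Fintype V] (E : V → V → Prop) :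
    2 * underlyingEdgeCount V E ≤ (univ.filter fun p : V × V => p.1 ≠ p.2 ∧ (E p.1 p.2 ∨ E p.2 p.1)).card := by
  unfold underlyingEdgeCount
  refine Finset.mul_card_image_le_card_of_maps_to (f := fun p => ({p.1, p.2} : Finset V)) ?_ 2 ?_
  · rintro ⟨a, b⟩ hp
    simp only [Finset.mem_filter, Finset.mem_univ, true_and] at hp
    refine Finset.mem_filter.2 ⟨Finset.mem_powersetCard.2 ⟨Finset.subset_univ _, Finset.card_pair hp.1⟩,
      a, b, hp.1, rfl, hp.2⟩
  · intro s hs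
    obtain ⟨u, v, huv, rfl, hE⟩ := (Finset.mem_filter.1 hs).2
    have : ({(u, v), (v, u)} : Finset (V × V)).card = 2 := Finset.card_pair (by simp [huv])
    rw [← this]
    refine Finset.card_le_card ?_
    intro p hp
    simp only [Finset.mem_insert, Finset.mem_singleton] at hp
    rcases hp with rfl | rfl
    · simp [huv, hE]
    · simp [huv.symm, hE.symm, Finset.pair_comm]

theorem nn_le {V : Type} [Fintype V] {E : V → V → Prop} (h : IsOrgraph E) (r : ℝ) (hr : 0 ≤ r) :
    av (fun _ => r) (nn (fun _ => r) (ee E)) ≤ r ^ 2 * ((Fintype.card V : ℝ) ^ 2 - 2 * underlyingEdgeCount V E) := by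
  classical
  unfold nn
  simp only [av_unif, ← Finset.mul_sum]
  have h1 : ∑ u : V, ∑ v : V, nb (ee E) u v ≤ (Fintype.card V : ℝ) ^ 2 - 2 * underlyingEdgeCount V E := by
    calc _ ≤ ∑ u : V, ∑ v : V, (1 - (if u ≠ v ∧ (E u v ∨ E v u) then (1 : ℝ) else 0)) := by
          refine Finset.sum_le_sum fun u _ => Finset.sum_le_sum fun v _ => ?_
          have k := h.2 u v
          unfold nb ee
          by_cases c : u = v
          · subst c
            simp [h.1 u]
          · by_cases a : E u v <;> by_cases b : E v u <;> simp [a, b, c] at k ⊢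
      _ = (Fintype.card V : ℝ) ^ 2 -
            ((univ.filter fun p : V × V => p.1 ≠ p.2 ∧ (E p.1 p.2 ∨ E p.2 p.1)).card : ℝ) := by
          rw [Finset.card_filter]
          push_cast
          simp only [Fintype.sum_prod_type, Finset.sum_sub_distrib]
          congr 1
          simp
          ring
      _ ≤ _ := by
          have : ((2 * underlyingEdgeCount V E : ℕ) : ℝ) ≤ _ := Nat.cast_le.2 (und_card E)
          push_cast at this
          linarith
  calc _ = r ^ 2 * ∑ u : V, ∑ v : V, nb (ee E) u v := by ring
    _ ≤ _ := mul_le_mul_of_nonneg_left h1 (by positivity)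

end FDFlb

/-- Stability version for density: there is an absolute ε₀ > 0 such that an
orgraph with at most δ·C(n,4) induced C⃗₄'s and underlying edge density at
least 2/3 − ε₀ has at least (4/9 − ε)·C(n,3) edges in FDF(Γ). -/
theorem stmt17 :
    ∃ ε₀ : ℝ, ε₀ > 0 ∧ ∀ ε : ℝ, ε > 0 → ∃ δ : ℝ, δ > 0 ∧ ∃ N : ℕ, ∀ n : ℕ, N ≤ n →
      ∀ E : Fin n → Fin n → Prop, IsOrgraph E →
        (c4Count (Fin n) E : ℝ) ≤ δ * (n.choose 4 : ℝ) →
        ((2 : ℝ) / 3 - ε₀) * (n.choose 2 : ℝ) ≤ (underlyingEdgeCount (Fin n) E : ℝ) →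
        ((4 : ℝ) / 9 - ε) * (n.choose 3 : ℝ) ≤ (fdfCount (Fin n) E : ℝ) := by
  refine ⟨1 / 10 ^ 25, by norm_num, fun ε hε => ⟨(ε / 2) ^ 2 / (2 * 10 ^ 12) / 256, by positivity,
    10 ^ 25 + ⌈6 / ε⌉₊, ?_⟩⟩
  intro n hN E hE hC hU
  have hn1 : (10 : ℝ) ^ 25 ≤ n := by
    have : 10 ^ 25 ≤ n := by omega
    exact_mod_cast this
  have hn2 : 6 / ε ≤ n := by
    have h1 : ⌈6 / ε⌉₊ ≤ n := by omega
    exact (Nat.le_ceil _).trans (by exact_mod_cast h1)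
  have hn0 : (0 : ℝ) < n := lt_of_lt_of_le (by positivity) hn1
  by_cases hε9 : 4 / 9 ≤ ε
  · have h1 : (0 : ℝ) ≤ (n.choose 3 : ℝ) := Nat.cast_nonneg _
    have h2 : (0 : ℝ) ≤ (fdfCount (Fin n) E : ℝ) := Nat.cast_nonneg _
    have h3 : ((4 : ℝ) / 9 - ε) * (n.choose 3 : ℝ) ≤ 0 :=
      mul_nonpos_of_nonpos_of_nonneg (by linarith) h1
    linarith
  push Not at hε9
  obtain ⟨r, hr⟩ : ∃ r : ℝ, r = 1 / n := ⟨_, rfl⟩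
  have hr0 : 0 ≤ r := by rw [hr]; positivity
  have hrn : r * n = 1 := by rw [hr]; field_simp
  have hr25 : r ≤ 1 / 10 ^ 25 := by
    rw [hr]; exact one_div_le_one_div_of_le (by positivity) hn1
  have hP := FDFlb.PP_le hE r hr0
  have h4 := FDFlb.C4_le hE r hr0
  have hn := FDFlb.nn_le hE r hr0
  rw [Fintype.card_fin] at hP hn
  have main := FDFlb.wmain (FDFlb.ee_OG hE) (w := fun _ => r) (fun _ => hr0)
    (by rw [FDFlb.av_unif]; simp [hrn]) ?_ (half_pos hε) ?_
  · have h5 : (4 / 9 - ε / 2) * (n : ℝ) ^ 3 ≤ 6 * fdfCount (Fin n) E + 3 * (n : ℝ) ^ 2 := by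
      have h6 := mul_le_mul_of_nonneg_right (main.trans hP) (by positivity : (0 : ℝ) ≤ (n : ℝ) ^ 3)
      have h7 : r ^ 3 * (6 * fdfCount (Fin n) E + 3 * (n : ℝ) ^ 2) * (n : ℝ) ^ 3 =
          (r * n) ^ 3 * (6 * fdfCount (Fin n) E + 3 * (n : ℝ) ^ 2) := by ring
      rw [h7, hrn] at h6
      linarith
    have hc : (n.choose 3 : ℝ) ≤ (n : ℝ) ^ 3 / 6 := by
      have := Nat.choose_le_pow_div (α := ℝ) 3 n
      have h6 : ((Nat.factorial 3 : ℕ) : ℝ) = 6 := by norm_num [Nat.factorial]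
      rwa [h6] at this
    have hc2 : (4 / 9 - ε) * (n.choose 3 : ℝ) ≤ (4 / 9 - ε) * ((n : ℝ) ^ 3 / 6) :=
      mul_le_mul_of_nonneg_left hc (by linarith)
    have h8 : 6 ≤ ε * n := by
      rw [div_le_iff₀ hε] at hn2; linarith
    have h9 : 6 * (n : ℝ) ^ 2 ≤ ε * n * (n : ℝ) ^ 2 := mul_le_mul_of_nonneg_right h8 (by positivity)
    have h10 : ε * n * (n : ℝ) ^ 2 = ε * (n : ℝ) ^ 3 := by ring
    linarith
  · refine hn.trans ?_
    rw [Nat.cast_choose_two] at hU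
    have h1 : r ^ 2 * ((n : ℝ) ^ 2 - 2 * underlyingEdgeCount (Fin n) E) ≤
        r ^ 2 * ((n : ℝ) ^ 2 - (2 / 3 - 1 / 10 ^ 25) * (n * (n - 1))) :=
      mul_le_mul_of_nonneg_left (by linarith) (by positivity)
    have h2 : r ^ 2 * ((n : ℝ) ^ 2 - (2 / 3 - 1 / 10 ^ 25) * (n * (n - 1))) =
        (r * n) ^ 2 - (2 / 3 - 1 / 10 ^ 25) * ((r * n) ^ 2 - r * (r * n)) := by ring
    rw [h2, hrn] at h1
    refine h1.trans ?_
    linarith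
  · refine h4.trans ?_
    have h1 : (n.choose 4 : ℝ) ≤ (n : ℝ) ^ 4 := by exact_mod_cast Nat.choose_le_pow n 4
    have h2 : (c4Count (Fin n) E : ℝ) ≤ (ε / 2) ^ 2 / (2 * 10 ^ 12) / 256 * (n : ℝ) ^ 4 :=
      hC.trans (mul_le_mul_of_nonneg_left h1 (by positivity))
    calc r ^ 4 * (256 * (c4Count (Fin n) E : ℝ))
        ≤ r ^ 4 * (256 * ((ε / 2) ^ 2 / (2 * 10 ^ 12) / 256 * (n : ℝ) ^ 4)) := by gcongr
      _ = (r * n) ^ 4 * ((ε / 2) ^ 2 / (2 * 10 ^ 12)) := by ring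
      _ = _ := by rw [hrn]; ring
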